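/- Let f and g be continuous, positive, non-increasing functions on [0,∞), let a > 0, r ∈ ℕ, n ∈ ℤ₊. Then there exists a perfect g-spline G ∈ Γ^r_{n,g}[0,a] having n+r+1 oscillation points, i.e., there exist n+r+1 points 0 ≤ t_1 < t_2 < ⋯ < t_{n+r+1} = a such that G(t_i) = (−1)^{i+r+1} ‖G‖_{C[0,a],f} · f(t_i) for all i = 1, 2, …, n+r+1. -/

import Mathlib

open Set Filter MeasureTheory
open scoped Topology

noncomputable section

/-- Weighted sup-norm `‖x‖_{C(S),w} = sup_{t ∈ S} |x t| / w t`. -/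
def wNorm (x w : ℝ → ℝ) (S : Set ℝ) : ℝ :=
  sSup ((fun t => |x t| / w t) '' S)

/-- Sup-norm `‖x‖_{C(S)} = sup_{t ∈ S} |x t|`. -/
def supNorm (x : ℝ → ℝ) (S : Set ℝ) : ℝ :=
  sSup ((fun t => |x t|) '' S)

/-- `G` is a perfect `g`-spline of order `r` on `[0,a]` with exactly `m` knots
`u 1 < ⋯ < u m` (where `u 0 = 0` and `u (m+1) = a`) and sign `ε ∈ {1,-1}`:
`G ∈ C^{r-1}[0,a]`, and on each open interval between consecutive knots `G` is
`r` times differentiable with `G^{(r)}(t) = ε·(-1)^i·g(t)` there. -/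
def PerfectSplineWith (g : ℝ → ℝ) (r : ℕ) (a : ℝ) (m : ℕ) (u : ℕ → ℝ) (ε : ℝ)
    (G : ℝ → ℝ) : Prop :=
  (ε = 1 ∨ ε = -1) ∧ u 0 = 0 ∧ u (m + 1) = a ∧ (∀ i ≤ m, u i < u (i + 1)) ∧
  ContDiffOn ℝ (r - 1 : ℕ) G (Icc 0 a) ∧
  ∀ i ≤ m, ContDiffOn ℝ (r : ℕ) G (Ioo (u i) (u (i + 1))) ∧
    ∀ s ∈ Ioo (u i) (u (i + 1)),
      iteratedDerivWithin r G (Ioo (u i) (u (i + 1))) s = ε * (-1 : ℝ) ^ i * g s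

/-- `Γ^r_{n,g}[0,a]`: perfect `g`-splines of order `r` on `[0,a]` with at most `n` knots. -/
def InGamma (g : ℝ → ℝ) (r n : ℕ) (a : ℝ) (G : ℝ → ℝ) : Prop :=
  ∃ m ≤ n, ∃ u : ℕ → ℝ, ∃ ε : ℝ, PerfectSplineWith g r a m u ε G

/-- `b 1 < ⋯ < b (n+r+1)` are `n+r+1` oscillation points of `G` on `[0,a]`
with respect to the weight `f`, as in (5). -/
def OscPointsAt (f : ℝ → ℝ) (r n : ℕ) (a : ℝ) (G : ℝ → ℝ) (b : ℕ → ℝ) : Prop :=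
  0 ≤ b 1 ∧ b (n + r + 1) = a ∧ (∀ i, 1 ≤ i → i < n + r + 1 → b i < b (i + 1)) ∧
  ∀ i, 1 ≤ i → i ≤ n + r + 1 →
    G (b i) = (-1 : ℝ) ^ (i + r + 1) * (wNorm G f (Icc 0 a) * f (b i))

/-- `G` has `n+r+1` oscillation points on `[0,a]`. -/
def HasOsc (f : ℝ → ℝ) (r n : ℕ) (a : ℝ) (G : ℝ → ℝ) : Prop :=
  ∃ b : ℕ → ℝ, OscPointsAt f r n a G b

/-- `G` is the extremal spline `G_{r,n,f,a}`: a member of `Γ^r_{n,g}[0,a]`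
with `n+r+1` oscillation points. -/
def IsExtremalSpline (f g : ℝ → ℝ) (r n : ℕ) (a : ℝ) (G : ℝ → ℝ) : Prop :=
  InGamma g r n a G ∧ HasOsc f r n a G

/-- Iterated antiderivatives: `g_0 = g`, `g_{k+1}(t) = ∫_0^t g_k`. -/
def gk (g : ℝ → ℝ) : ℕ → ℝ → ℝ
  | 0 => g
  | k + 1 => fun t => ∫ s in (0:ℝ)..t, gk g k s

/-- The constants `A_k` of the paper:
`A_0 = ∫_0^∞ g`, and
`A_k = ∫_0^∞ [ Σ_{s=0}^{k-1} (-1)^{k-s-1} A_s t^{k-s-1}/(k-s-1)! + (-1)^k g_k(t) ] dt`. -/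
def Acoef (g : ℝ → ℝ) : ℕ → ℝ
  | 0 => ∫ t in Ioi (0 : ℝ), g t
  | k + 1 => ∫ t in Ioi (0 : ℝ),
      ((∑ s : Fin (k + 1), (-1 : ℝ) ^ (k - s.1) * Acoef g s.1 * t ^ (k - s.1) /
        (Nat.factorial (k - s.1) : ℝ)) + (-1 : ℝ) ^ (k + 1) * gk g (k + 1) t)

/-- `P_k(t) = Σ_{s=0}^{k-1} (-1)^{k-s-1} A_s t^{k-s-1}/(k-s-1)! + (-1)^k g_k(t)`. -/
def Pfun (g : ℝ → ℝ) (k : ℕ) (t : ℝ) : ℝ :=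
  (∑ s : Fin k, (-1 : ℝ) ^ (k - 1 - s.1) * Acoef g s.1 * t ^ (k - 1 - s.1) /
    (Nat.factorial (k - 1 - s.1) : ℝ)) + (-1 : ℝ) ^ k * gk g k t

/-- Conditions (6): `A_0 < ∞` and `A_k < ∞` for `k = 1, …, r-1`,
expressed as integrability of the corresponding integrands over `(0,∞)`. -/
def Cond6 (g : ℝ → ℝ) (r : ℕ) : Prop :=
  IntegrableOn g (Ioi 0) ∧ ∀ k, 1 ≤ k → k ≤ r - 1 → IntegrableOn (Pfun g k) (Ioi 0)

/-- Membership in the class `W^r_{f,g}(ℝ₊)`: `x ∈ C[0,∞)` with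
`‖x‖_{C[0,∞),f} < ∞`, `x ∈ C^{r-1}[0,∞)`, `x^{(r-1)}` locally absolutely
continuous with `|x^{(r)}| ≤ g` a.e., the latter encoded by the increment bound
`|x^{(r-1)}(t) - x^{(r-1)}(s)| ≤ ∫_s^t g`. -/
def MemW (f g : ℝ → ℝ) (r : ℕ) (x : ℝ → ℝ) : Prop :=
  ContinuousOn x (Ici 0) ∧
  ContDiffOn ℝ (r - 1 : ℕ) x (Ici 0) ∧
  BddAbove ((fun t => |x t| / f t) '' Ici 0) ∧
  ∀ s t : ℝ, 0 ≤ s → s ≤ t →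
    |iteratedDerivWithin (r - 1) x (Ici 0) t - iteratedDerivWithin (r - 1) x (Ici 0) s| ≤
      ∫ u in s..t, g u

/-- The modulus of continuity `ω(D^k, δ)` of the `k`-th differentiation operator on
`W^r_{f,g}(ℝ₊)`. -/
def omegaD (f g : ℝ → ℝ) (r k : ℕ) (δ : ℝ) : ℝ :=
  sSup {y | ∃ x : ℝ → ℝ, MemW f g r x ∧ wNorm x f (Ici 0) ≤ δ ∧
    y = supNorm (iteratedDerivWithin k x (Ici 0)) (Ici 0)}

/-- A perfect `g`-spline of order `r` on `[0,∞)` with exactly `n` knots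
`u 1 < ⋯ < u n` (and `u 0 = 0`), sign `ε`. -/
def PerfectSplineInf (g : ℝ → ℝ) (r n : ℕ) (u : ℕ → ℝ) (ε : ℝ) (Q : ℝ → ℝ) : Prop :=
  (ε = 1 ∨ ε = -1) ∧ u 0 = 0 ∧ (∀ i < n, u i < u (i + 1)) ∧
  ContDiffOn ℝ (r - 1 : ℕ) Q (Ici 0) ∧
  (∀ i < n, ContDiffOn ℝ (r : ℕ) Q (Ioo (u i) (u (i + 1))) ∧
    ∀ s ∈ Ioo (u i) (u (i + 1)),
      iteratedDerivWithin r Q (Ioo (u i) (u (i + 1))) s = ε * (-1 : ℝ) ^ i * g s) ∧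
  ContDiffOn ℝ (r : ℕ) Q (Ioi (u n)) ∧
  ∀ s ∈ Ioi (u n), iteratedDerivWithin r Q (Ioi (u n)) s = ε * (-1 : ℝ) ^ n * g s

end

def AltP (F : ℝ → ℝ) (k : ℕ) (σ : ℝ) : Prop :=
  ∃ s : ℕ → ℝ, (∀ i, i + 1 < k → s i < s (i + 1)) ∧ ∀ i < k, 0 < σ * (-1) ^ i * F (s i)

def IncAlt (F : ℝ → ℝ) (k : ℕ) (σ : ℝ) : Prop :=
  ∃ s : ℕ → ℝ, (∀ i < k, s i < s (i + 1)) ∧ ∀ i < k, 0 < σ * (-1) ^ i * (F (s (i + 1)) - F (s i))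

lemma AltP.inc {F : ℝ → ℝ} {k : ℕ} {σ : ℝ} (h : AltP F (k + 1) σ) : IncAlt F k (-σ) := by
  obtain ⟨s, h1, h2⟩ := h
  refine ⟨s, fun i hi => h1 i (by omega), fun i hi => ?_⟩
  have a := h2 i (by omega)
  have b := h2 (i + 1) (by omega)
  rw [pow_succ] at b
  linarith

lemma AltP.tail {F : ℝ → ℝ} {k : ℕ} {σ : ℝ} (h : AltP F (k + 1) σ) : AltP F k (-σ) := by
  obtain ⟨s, h1, h2⟩ := h
  refine ⟨fun i => s (i + 1), fun i hi => h1 (i + 1) (by omega), fun i hi => ?_⟩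
  have b := h2 (i + 1) (by omega)
  rw [pow_succ] at b
  linarith

lemma AltP.mono {F : ℝ → ℝ} {k l : ℕ} {σ : ℝ} (h : AltP F k σ) (hl : l ≤ k) : AltP F l σ := by
  obtain ⟨s, h1, h2⟩ := h
  exact ⟨s, fun i hi => h1 i (by omega), fun i hi => h2 i (by omega)⟩

lemma AltP.congr_pos {F H q : ℝ → ℝ} {k : ℕ} {σ : ℝ} (h : AltP F k σ) (hq : ∀ x, 0 < q x)
    (hF : ∀ x, F x = q x * H x) : AltP H k σ := by
  obtain ⟨s, h1, h2⟩ := h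
  refine ⟨s, h1, fun i hi => ?_⟩
  have := h2 i hi
  rw [hF] at this
  have h3 : 0 < q (s i) * (σ * (-1) ^ i * H (s i)) := by linarith
  exact (mul_pos_iff_of_pos_left (hq _)).1 h3

lemma IncAlt.deriv {F F' : ℝ → ℝ} {k : ℕ} {σ : ℝ} (hF : ∀ x, HasDerivAt F (F' x) x)
    (h : IncAlt F k σ) : AltP F' k σ := by
  obtain ⟨s, h1, h2⟩ := h
  have : ∀ i, ∃ x, i < k → x ∈ Ioo (s i) (s (i + 1)) ∧ F' x = (F (s (i + 1)) - F (s i)) / (s (i + 1) - s i) := by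
    intro i
    by_cases hi : i < k
    · obtain ⟨x, hx, hx'⟩ := exists_hasDerivAt_eq_slope F F' (h1 i hi)
        (fun x _ => (hF x).continuousAt.continuousWithinAt) (fun x _ => hF x)
      exact ⟨x, fun _ => ⟨hx, hx'⟩⟩
    · exact ⟨0, fun h => absurd h hi⟩
  choose x hx using this
  refine ⟨x, fun i hi => ?_, fun i hi => ?_⟩
  · exact (hx i (by omega)).1.2.trans (hx (i + 1) hi).1.1
  · rw [(hx i hi).2, ← mul_div_assoc]
    exact div_pos (h2 i hi) (sub_pos.2 (h1 i hi))

/-- Descartes-type rule for exponential sums. -/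
lemma expsum_sign : ∀ (M : ℕ) (b α : ℕ → ℝ) (σ : ℝ), (∀ i < M, α i < α (i + 1)) →
    AltP (fun s => ∑ i ∈ Finset.range (M + 1), b i * Real.exp (α i * s)) (M + 1) σ → 0 < σ * b 0 := by
  intro M
  induction M with
  | zero =>
    intro b α σ _ h
    obtain ⟨s, -, h2⟩ := h
    have := h2 0 (by omega)
    simp only [zero_add, Finset.range_one, Finset.sum_singleton, pow_zero, mul_one, ← mul_assoc] at this
    exact (mul_pos_iff_of_pos_right (Real.exp_pos _)).1 this
  | succ M ih =>
    intro b α σ hα h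
    have h' : AltP (fun s => ∑ i ∈ Finset.range (M + 2), b i * Real.exp ((α i - α (M + 1)) * s)) (M + 2) σ := by
      refine h.congr_pos (q := fun s => Real.exp (α (M + 1) * s)) (fun _ => Real.exp_pos _) ?_
      intro x
      rw [Finset.mul_sum]
      refine Finset.sum_congr rfl fun i _ => ?_
      rw [mul_left_comm, ← Real.exp_add]; congr 2; ring
    have hd : ∀ x, HasDerivAt (fun s => ∑ i ∈ Finset.range (M + 2), b i * Real.exp ((α i - α (M + 1)) * s))
        (∑ i ∈ Finset.range (M + 1), (b i * (α i - α (M + 1))) * Real.exp ((α i - α (M + 1)) * x)) x := by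
      intro x
      have : HasDerivAt (fun s => ∑ i ∈ Finset.range (M + 2), b i * Real.exp ((α i - α (M + 1)) * s))
        (∑ i ∈ Finset.range (M + 2), (b i * (α i - α (M + 1))) * Real.exp ((α i - α (M + 1)) * x)) x := by
        refine HasDerivAt.fun_sum fun i _ => ?_
        have h1 : HasDerivAt (fun s : ℝ => (α i - α (M + 1)) * s) (α i - α (M + 1)) x := by
          simpa using (hasDerivAt_id x).const_mul (α i - α (M + 1))
        exact (h1.exp.const_mul (b i)).congr_deriv (by ring)
      rw [Finset.sum_range_succ] at this
      simpa using this
    have h3 := ih _ _ _ (fun i hi => by have := hα i (by omega); linarith) (h'.inc.deriv hd)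
    have hlt : ∀ j, j ≤ M → α 0 < α (j + 1) := by
      intro j
      induction j with
      | zero => intro _; exact hα 0 (by omega)
      | succ j ihj => intro hj; exact (ihj (by omega)).trans (hα (j + 1) (by omega))
    have := hlt M le_rfl
    nlinarith

/-- zeros indexed by sequences -/
def ZeroP (F : ℝ → ℝ) (k : ℕ) : Prop :=
  ∃ s : ℕ → ℝ, (∀ i, i + 1 < k → s i < s (i + 1)) ∧ ∀ i < k, F (s i) = 0

lemma ZeroP.deriv {F F' : ℝ → ℝ} {k : ℕ} (hF : ∀ x, HasDerivAt F (F' x) x)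
    (h : ZeroP F (k + 1)) : ZeroP F' k := by
  obtain ⟨s, h1, h2⟩ := h
  have : ∀ i, ∃ x, i < k → x ∈ Ioo (s i) (s (i + 1)) ∧ F' x = 0 := by
    intro i
    by_cases hi : i < k
    · obtain ⟨x, hx, hx'⟩ := exists_hasDerivAt_eq_zero (h1 i (by omega))
        (fun x _ => (hF x).continuousAt.continuousWithinAt) (by rw [h2 i (by omega), h2 (i + 1) (by omega)]) (fun x _ => hF x)
      exact ⟨x, fun _ => ⟨hx, hx'⟩⟩
    · exact ⟨0, fun h => absurd h hi⟩
  choose x hx using this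
  exact ⟨x, fun i hi => (hx i (by omega)).1.2.trans (hx (i + 1) hi).1.1, fun i hi => (hx i hi).2⟩

lemma expsum_zero : ∀ (M : ℕ) (b α : ℕ → ℝ), (∀ i, i + 1 < M → α i < α (i + 1)) →
    ZeroP (fun s => ∑ i ∈ Finset.range M, b i * Real.exp (α i * s)) M → ∀ i < M, b i = 0 := by
  intro M
  induction M with
  | zero => intro b α _ _ i hi; omega
  | succ M ih =>
    intro b α hα h
    have h' : ZeroP (fun s => ∑ i ∈ Finset.range (M + 1), b i * Real.exp ((α i - α M) * s)) (M + 1) := by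
      obtain ⟨s, h1, h2⟩ := h
      refine ⟨s, h1, fun i hi => ?_⟩
      have := h2 i hi
      have h4 : ∑ j ∈ Finset.range (M + 1), b j * Real.exp (α j * s i) = Real.exp (α M * s i) *
        ∑ j ∈ Finset.range (M + 1), b j * Real.exp ((α j - α M) * s i) := by
        rw [Finset.mul_sum]
        refine Finset.sum_congr rfl fun i _ => ?_
        rw [mul_left_comm, ← Real.exp_add]; congr 2; ring
      simp only [h4] at this
      exact (mul_eq_zero.1 this).resolve_left (Real.exp_pos _).ne'
    have hd : ∀ x, HasDerivAt (fun s => ∑ i ∈ Finset.range (M + 1), b i * Real.exp ((α i - α M) * s))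
        (∑ i ∈ Finset.range M, (b i * (α i - α M)) * Real.exp ((α i - α M) * x)) x := by
      intro x
      have : HasDerivAt (fun s => ∑ i ∈ Finset.range (M + 1), b i * Real.exp ((α i - α M) * s))
        (∑ i ∈ Finset.range (M + 1), (b i * (α i - α M)) * Real.exp ((α i - α M) * x)) x := by
        refine HasDerivAt.fun_sum fun i _ => ?_
        have h1 : HasDerivAt (fun s : ℝ => (α i - α M) * s) (α i - α M) x := by
          simpa using (hasDerivAt_id x).const_mul (α i - α M)
        exact (h1.exp.const_mul (b i)).congr_deriv (by ring)
      rw [Finset.sum_range_succ] at this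
      simpa using this
    have h3 := ih _ _ (fun i hi => by have := hα i (by omega); linarith) (h'.deriv hd)
    have hlt : ∀ j i, i + j < M → α i < α (i + j + 1) := by
      intro j
      induction j with
      | zero => intro i hi; exact hα i (by omega)
      | succ j ihj => intro i hj; exact (ihj i (by omega)).trans (hα (i + j + 1) (by omega))
    have h5 : ∀ i < M, b i = 0 := by
      intro i hi
      have h6 := hlt (M - 1 - i) i (by omega)
      rw [show i + (M - 1 - i) + 1 = M by omega] at h6
      exact (mul_eq_zero.1 (h3 i hi)).resolve_right (by linarith)
    intro i hi
    rcases Nat.lt_succ_iff_lt_or_eq.1 hi with h6 | rfl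
    · exact h5 i h6
    · obtain ⟨s, h1, h2⟩ := h'
      have := h2 0 (by omega)
      simp only [Finset.sum_range_succ] at this
      rw [Finset.sum_eq_zero (fun j hj => by rw [h5 j (Finset.mem_range.1 hj), zero_mul])] at this
      simpa using this

noncomputable def PP (c : ℕ → ℝ) (w : ℝ → ℝ) : ℕ → ℝ → ℝ
  | 0 => w
  | k + 1 => fun t => c k + ∫ s in (0:ℝ)..t, PP c w k s

def LI (w : ℝ → ℝ) : Prop := ∀ x y : ℝ, IntervalIntegrable w volume x y

lemma LI.of_cont {w : ℝ → ℝ} (h : Continuous w) : LI w := fun x y => h.intervalIntegrable x y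

lemma PP_succ (c : ℕ → ℝ) (w : ℝ → ℝ) (k : ℕ) (t : ℝ) :
    PP c w (k + 1) t = c k + ∫ s in (0:ℝ)..t, PP c w k s := rfl

lemma PP_cont_of_li {c : ℕ → ℝ} {w : ℝ → ℝ} {k : ℕ} (h : LI (PP c w k)) : Continuous (PP c w (k + 1)) :=
  continuous_const.add (intervalIntegral.continuous_primitive h 0)

lemma PP_li {c : ℕ → ℝ} {w : ℝ → ℝ} (h : LI w) : ∀ k, LI (PP c w k)
  | 0 => h
  | k + 1 => LI.of_cont (PP_cont_of_li (PP_li h k))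

lemma PP_cont {c : ℕ → ℝ} {w : ℝ → ℝ} (h : LI w) (k : ℕ) : Continuous (PP c w (k + 1)) :=
  PP_cont_of_li (PP_li h k)

lemma PP_cont' {c : ℕ → ℝ} {w : ℝ → ℝ} (h : Continuous w) : ∀ k : ℕ, Continuous (PP c w k)
  | 0 => h
  | k + 1 => PP_cont (LI.of_cont h) k

lemma PP_deriv_at {c : ℕ → ℝ} {w : ℝ → ℝ} (h : LI w) (k : ℕ) (t : ℝ)
    (hm : StronglyMeasurableAtFilter (PP c w k) (𝓝 t)) (hc : ContinuousAt (PP c w k) t) :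
    HasDerivAt (PP c w (k + 1)) (PP c w k t) t :=
  (intervalIntegral.integral_hasDerivAt_right (PP_li h k 0 t) hm hc).const_add (c k)

lemma PP_deriv {c : ℕ → ℝ} {w : ℝ → ℝ} (h : LI w) (k : ℕ) (t : ℝ) :
    HasDerivAt (PP c w (k + 2)) (PP c w (k + 1) t) t :=
  PP_deriv_at h (k + 1) t ((PP_cont h k).stronglyMeasurableAtFilter _ _) (PP_cont h k).continuousAt

lemma PP_deriv' {c : ℕ → ℝ} {w : ℝ → ℝ} (h : Continuous w) (k : ℕ) (t : ℝ) :
    HasDerivAt (PP c w (k + 1)) (PP c w k t) t :=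
  PP_deriv_at (LI.of_cont h) k t ((PP_cont' h k).stronglyMeasurableAtFilter _ _) (PP_cont' h k).continuousAt

lemma PP_lin {c d : ℕ → ℝ} {w v : ℝ → ℝ} (hw : LI w) (hv : LI v) (δ : ℝ) (k : ℕ) (t : ℝ) :
    PP (fun j => c j + δ * d j) (fun s => w s + δ * v s) k t = PP c w k t + δ * PP d v k t := by
  induction k generalizing t with
  | zero => rfl
  | succ k ih =>
    simp only [PP_succ, ih]
    rw [intervalIntegral.integral_add (PP_li hw k _ _) ((PP_li hv k _ _).const_mul δ),
      intervalIntegral.integral_const_mul]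
    ring

lemma PP_congr {c d : ℕ → ℝ} {w : ℝ → ℝ} (k : ℕ) (h : ∀ j < k, c j = d j) (t : ℝ) :
    PP c w k t = PP d w k t := by
  induction k generalizing t with
  | zero => rfl
  | succ k ih =>
    simp only [PP_succ]
    rw [h k (by omega)]
    congr 2
    ext s
    exact ih (fun j hj => h j (by omega)) s

lemma PP_bound {c : ℕ → ℝ} {w : ℝ → ℝ} {a D I : ℝ} (hw : LI w) (ha : 0 ≤ a)
    (hc : ∀ j, |c j| ≤ D) (hI : ∫ s in (0:ℝ)..a, |w s| ≤ I) (k : ℕ) :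
    ∀ t ∈ Icc (0:ℝ) a, |PP c w (k + 1) t| ≤ (D + I) * (1 + a) ^ k := by
  have hD : 0 ≤ D := (abs_nonneg _).trans (hc 0)
  have hI0 : 0 ≤ I := (intervalIntegral.integral_nonneg ha (fun _ _ => abs_nonneg _)).trans hI
  induction k with
  | zero =>
    intro t ht
    simp only [PP_succ, pow_zero, mul_one]
    have h1 : |∫ s in (0:ℝ)..t, w s| ≤ ∫ s in (0:ℝ)..t, |w s| :=
      intervalIntegral.abs_integral_le_integral_abs ht.1
    have h2 : ∫ s in (0:ℝ)..t, |w s| ≤ ∫ s in (0:ℝ)..a, |w s| :=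
      intervalIntegral.integral_mono_interval le_rfl ht.1 ht.2
        (Eventually.of_forall fun _ => abs_nonneg _) (hw 0 a).abs
    have h3 := abs_add_le (c 0) (∫ s in (0:ℝ)..t, w s)
    have := hc 0
    change |c 0 + ∫ s in (0:ℝ)..t, w s| ≤ _
    linarith
  | succ k ih =>
    intro t ht
    rw [PP_succ]
    have h1 : |∫ s in (0:ℝ)..t, PP c w (k + 1) s| ≤ (D + I) * (1 + a) ^ k * |t - 0| := by
      rw [← Real.norm_eq_abs]
      refine intervalIntegral.norm_integral_le_of_norm_le_const fun s hs => ?_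
      rw [uIoc_of_le ht.1] at hs
      exact ih s ⟨hs.1.le, hs.2.trans ht.2⟩
    rw [sub_zero, abs_of_nonneg ht.1] at h1
    have h3 := abs_add_le (c (k + 1)) (∫ s in (0:ℝ)..t, PP c w (k + 1) s)
    have h4 := hc (k + 1)
    have h5 : 1 ≤ (1 + a) ^ k := one_le_pow₀ (by linarith)
    have h6 : 0 ≤ (D + I) * (1 + a) ^ k := by positivity
    have h7 := mul_le_mul_of_nonneg_left ht.2 h6
    rw [pow_succ]
    nlinarith

lemma PP_alt {c : ℕ → ℝ} {w : ℝ → ℝ} (h : Continuous w) (N : ℕ) : ∀ (k : ℕ) (σ : ℝ),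
    AltP (PP c w k) (N + k) σ → AltP w N (σ * (-1) ^ k) := by
  intro k
  induction k with
  | zero => intro σ hh; simpa [PP] using hh
  | succ k ih =>
    intro σ hh
    have := ih _ ((AltP.inc (k := N + k) hh).deriv (PP_deriv' h k))
    rw [pow_succ]
    convert this using 1; ring

lemma PP_zero {c : ℕ → ℝ} {w : ℝ → ℝ} (h : Continuous w) (N : ℕ) : ∀ (k : ℕ),
    ZeroP (PP c w k) (N + k) → ZeroP w N := by
  intro k
  induction k with
  | zero => intro hh; simpa [PP] using hh
  | succ k ih =>
    intro hh
    exact ih (ZeroP.deriv (k := N + k) (PP_deriv' h k) hh)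

lemma PP_coef {c : ℕ → ℝ} : ∀ k : ℕ, ZeroP (PP c (fun _ => 0) k) k →
    (∀ j < k, c j = 0) ∧ ∀ t, PP c (fun _ => 0) k t = 0 := by
  intro k
  induction k with
  | zero => intro _; exact ⟨fun j hj => by omega, fun t => rfl⟩
  | succ k ih =>
    intro h
    obtain ⟨h1, h2⟩ := ih (h.deriv (PP_deriv' continuous_const k))
    have h3 : ∀ t, PP c (fun _ => 0) (k + 1) t = c k := by
      intro t; rw [PP_succ]; simp [h2]
    have h4 : c k = 0 := by
      obtain ⟨s, _, hs⟩ := h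
      rw [← h3 (s 0)]; exact hs 0 (by omega)
    refine ⟨fun j hj => ?_, fun t => by rw [h3, h4]⟩
    rcases Nat.lt_succ_iff_lt_or_eq.1 hj with h6 | rfl
    · exact h1 j h6
    · exact h4

def extc {r : ℕ} (c : Fin r → ℝ) : ℕ → ℝ := fun j => if h : j < r then c ⟨j, h⟩ else 0

lemma PP_coef_bound (r : ℕ) {a : ℝ} (ha : 0 < a) : ∃ C : ℝ, 0 ≤ C ∧ ∀ (c : ℕ → ℝ) (A : ℝ),
    (∀ t ∈ Icc (0:ℝ) a, |PP c (fun _ => 0) r t| ≤ A) → ∀ j < r, |c j| ≤ C * A := by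
  let x : ℕ → ℝ := fun i => a * (i / (r + 1))
  have hx : ∀ i, i < r → x i ∈ Icc 0 a := by
    intro i hi
    have h1 : (i:ℝ) < r := by exact_mod_cast hi
    have : (i:ℝ) / (r + 1) ≤ 1 := by rw [div_le_one (by positivity)]; linarith
    exact ⟨by positivity, by nlinarith⟩
  have hlin : ∀ (c d : Fin r → ℝ) (δ t : ℝ), PP (extc (c + δ • d)) (fun _ => 0) r t =
      PP (extc c) (fun _ => 0) r t + δ * PP (extc d) (fun _ => 0) r t := by
    intro c d δ t
    rw [← PP_lin (LI.of_cont continuous_const) (LI.of_cont continuous_const)]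
    congr 1
    · ext j; simp only [extc]; split_ifs <;> simp
    · simp
  have h0 : ∀ t, PP (extc (0 : Fin r → ℝ)) (fun _ => 0) r t = 0 := by
    intro t
    have := hlin 0 0 1 t
    simp at this; exact this
  let L : (Fin r → ℝ) →ₗ[ℝ] (Fin r → ℝ) :=
    { toFun := fun c i => PP (extc c) (fun _ => 0) r (x i)
      map_add' := fun c d => by
        ext i
        have := hlin c d 1 (x i)
        simpa using this
      map_smul' := fun δ d => by
        ext i
        have := hlin 0 d δ (x i)
        simpa [h0] using this }
  have hker : LinearMap.ker L = ⊥ := by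
    rw [LinearMap.ker_eq_bot']
    intro c hc
    have : ZeroP (PP (extc c) (fun _ => 0) r) r := by
      refine ⟨x, fun i hi => ?_, fun i hi => ?_⟩
      · simp only [x]
        have : (i:ℝ) / (r + 1) < ((i + 1 : ℕ) : ℝ) / (r + 1) := by
          apply div_lt_div_of_pos_right _ (by positivity)
          push_cast; linarith
        exact mul_lt_mul_of_pos_left this ha
      · exact congrFun hc ⟨i, hi⟩
    have := (PP_coef r this).1
    ext i
    have h2 := this i i.2
    simpa [extc] using h2
  obtain ⟨K, hK, hL⟩ := LinearMap.exists_antilipschitzWith L hker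
  refine ⟨K, K.2, fun c A hA j hj => ?_⟩
  let c' : Fin r → ℝ := fun i => c i
  have h1 := hL.le_mul_dist c' 0
  rw [map_zero, dist_zero_right, dist_zero_right] at h1
  have hA0 : 0 ≤ A := (abs_nonneg _).trans (hA 0 ⟨le_rfl, ha.le⟩)
  have h2 : ‖L c'‖ ≤ A := by
    rw [pi_norm_le_iff_of_nonneg hA0]
    intro i
    have := hA (x i) (hx i i.2)
    rw [PP_congr (d := extc c') r (fun j hj => by simp [extc, hj, c'])] at this
    exact this
  have h3 := norm_le_pi_norm c' ⟨j, hj⟩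
  calc |c j| ≤ ‖c'‖ := h3
    _ ≤ K * ‖L c'‖ := h1
    _ ≤ K * A := by gcongr

/-- `x` lies in the `j`-th gap of the points `y 0 < ⋯ < y (d-1)`. -/
def InGap (y : ℕ → ℝ) (d j : ℕ) (x : ℝ) : Prop :=
  (∀ i, i < j → i < d → y i < x) ∧ ∀ i, j ≤ i → i < d → x < y i

lemma strict_of_succ {y : ℕ → ℝ} {d : ℕ} (hy : ∀ i, i + 1 < d → y i < y (i + 1)) :
    ∀ i j, i < j → j < d → y i < y j := by
  intro i j hij
  induction j with
  | zero => omega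
  | succ j ih =>
    intro hj
    rcases Nat.lt_succ_iff_lt_or_eq.1 hij with h | rfl
    · exact (ih h (by omega)).trans (hy j hj)
    · exact hy i hj

lemma haar_sign {V : Type*} [AddCommGroup V] [Module ℝ V] [FiniteDimensional ℝ V]
    (L : V →ₗ[ℝ] (ℝ → ℝ)) (d : ℕ) (hd : Module.finrank ℝ V = d + 1) (hc : ∀ v, Continuous (L v))
    (hz : ∀ v, ∀ S : Finset ℝ, S.card = d + 1 → (∀ x ∈ S, L v x = 0) → v = 0)
    (y : ℕ → ℝ) (hy : ∀ i, i + 1 < d → y i < y (i + 1)) :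
    ∃ v, ∀ x, ∀ j ≤ d, InGap y d j x → 0 < (-1) ^ j * L v x := by
  classical
  have hlt := strict_of_succ hy
  have hinj : Set.InjOn y (Finset.range d : Set ℕ) := by
    intro i hi j hj hij
    simp at hi hj
    rcases lt_trichotomy i j with h | h | h
    · exact absurd hij (hlt i j h hj).ne
    · exact h
    · exact absurd hij (hlt j i h hi).ne'
  set Y := (Finset.range d).image y with hY
  have hYc : Y.card = d := by rw [hY, Finset.card_image_of_injOn hinj, Finset.card_range]
  have hYmem : ∀ i < d, y i ∈ Y := fun i hi => Finset.mem_image_of_mem _ (Finset.mem_range.2 hi)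
  have hgapY : ∀ x j, InGap y d j x → x ∉ Y := by
    intro x j hx hxY
    obtain ⟨i, hi, rfl⟩ := Finset.mem_image.1 hxY
    rw [Finset.mem_range] at hi
    rcases lt_or_ge i j with h | h
    · exact lt_irrefl _ (hx.1 i h hi)
    · exact lt_irrefl _ (hx.2 i h hi)
  -- evaluation
  let ev : V →ₗ[ℝ] (Fin d → ℝ) :=
    { toFun := fun v i => L v (y i), map_add' := fun u v => by ext; simp, map_smul' := fun c v => by ext; simp }
  obtain ⟨v, hv, hv0⟩ : ∃ v, v ∈ LinearMap.ker ev ∧ v ≠ 0 := by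
    apply (Submodule.ne_bot_iff _).1
    apply LinearMap.ker_ne_bot_of_finrank_lt
    rw [hd]; simp
  have hvY : ∀ x ∈ Y, L v x = 0 := by
    intro x hx
    obtain ⟨i, hi, rfl⟩ := Finset.mem_image.1 hx
    exact congrFun (LinearMap.mem_ker.1 hv) ⟨i, Finset.mem_range.1 hi⟩
  have hvne : ∀ x, x ∉ Y → L v x ≠ 0 := by
    intro x hx h0
    apply hv0
    refine hz v (insert x Y) (by rw [Finset.card_insert_of_notMem hx, hYc]) ?_
    intro z hz'
    rcases Finset.mem_insert.1 hz' with rfl | h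
    · exact h0
    · exact hvY z h
  have hinterp : ∀ j < d, ∀ p ∉ Y, ∃ w, L w (y j) = 1 ∧ ∀ x ∈ Y.erase (y j), L w x = 0 := by
    intro j hj p hp
    have hpc : (insert p Y).card = d + 1 := by rw [Finset.card_insert_of_notMem hp, hYc]
    have hYZ : ∀ x ∈ Y, x ∈ insert p Y := fun x hx => Finset.mem_insert_of_mem hx
    generalize (insert p Y) = Z at hpc hYZ
    let ev2 : V →ₗ[ℝ] (Z → ℝ) :=
      { toFun := fun v i => L v i.1, map_add' := fun u v => by ext; simp, map_smul' := fun c v => by ext; simp }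
    have hi : Function.Injective ev2 := by
      rw [← LinearMap.ker_eq_bot, LinearMap.ker_eq_bot']
      intro u hu
      refine hz u Z hpc ?_
      intro x hx
      exact congrFun hu ⟨x, hx⟩
    have hs : Function.Surjective ev2 := by
      refine (LinearMap.injective_iff_surjective_of_finrank_eq_finrank ?_).1 hi
      rw [hd, Module.finrank_fintype_fun_eq_card, Fintype.card_coe, hpc]
    obtain ⟨w, hw⟩ := hs (fun x => if (x : ℝ) = y j then 1 else 0)
    refine ⟨w, ?_, ?_⟩
    · have := congrFun hw ⟨y j, hYZ _ (hYmem j hj)⟩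
      simpa [ev2] using this
    · intro x hx
      rw [Finset.mem_erase] at hx
      have := congrFun hw ⟨x, hYZ _ hx.2⟩
      simpa [ev2, hx.1] using this
  have hstep : ∀ v : V, (∀ x ∈ Y, L v x = 0) → ∀ j < d, ∀ p q, InGap y d j p → InGap y d (j + 1) q →
      0 < L v p → 0 < L v q → False := by
    intro v hvY j hj p q hp hq hvp hvq
    obtain ⟨w, hw1, hw2⟩ := hinterp j hj p (hgapY p j hp)
    have hpy : p < y j := hp.2 j le_rfl hj
    have hqy : y j < q := hq.1 j (by omega) hj
    set D := 1 + |L w p| + |L w q| with hD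
    have hD0 : 0 < D := by positivity
    set δ := min (L v p) (L v q) / (2 * D) with hδ
    have hm : 0 < min (L v p) (L v q) := lt_min hvp hvq
    have hδ0 : 0 < δ := by positivity
    have hδD : δ * D = min (L v p) (L v q) / 2 := by rw [hδ]; field_simp
    have e1 : δ * |L w p| ≤ δ * D := by
      apply mul_le_mul_of_nonneg_left _ hδ0.le
      rw [hD]; have := abs_nonneg (L w q); linarith
    have e2 : δ * |L w q| ≤ δ * D := by
      apply mul_le_mul_of_nonneg_left _ hδ0.le
      rw [hD]; have := abs_nonneg (L w p); linarith
    have m1 := min_le_left (L v p) (L v q)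
    have m2 := min_le_right (L v p) (L v q)
    have f1 : 0 < L (v - δ • w) p := by
      simp only [map_sub, map_smul, Pi.sub_apply, Pi.smul_apply, smul_eq_mul]
      have := mul_le_mul_of_nonneg_left (le_abs_self (L w p)) hδ0.le
      linarith
    have f2 : 0 < L (v - δ • w) q := by
      simp only [map_sub, map_smul, Pi.sub_apply, Pi.smul_apply, smul_eq_mul]
      have := mul_le_mul_of_nonneg_left (le_abs_self (L w q)) hδ0.le
      linarith
    have f3 : L (v - δ • w) (y j) < 0 := by
      simp only [map_sub, map_smul, Pi.sub_apply, Pi.smul_apply, smul_eq_mul, hw1, hvY _ (hYmem j hj)]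
      linarith
    obtain ⟨z1, hz1, hz1'⟩ := intermediate_value_Ioo' hpy.le (hc (v - δ • w)).continuousOn ⟨f3, f1⟩
    obtain ⟨z2, hz2, hz2'⟩ := intermediate_value_Ioo hqy.le (hc (v - δ • w)).continuousOn ⟨f3, f2⟩
    have g1 : InGap y d j z1 := ⟨fun i h1 h2 => (hp.1 i h1 h2).trans hz1.1, fun i h1 h2 => by
      rcases h1.eq_or_lt with rfl | h1
      · exact hz1.2
      · exact hz1.2.trans (hlt j i h1 h2)⟩
    have g2 : InGap y d (j + 1) z2 := ⟨fun i h1 h2 => by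
      rcases Nat.lt_succ_iff_lt_or_eq.1 h1 with h1 | rfl
      · exact (hlt i j h1 hj).trans hz2.1
      · exact hz2.1, fun i h1 h2 => hz2.2.trans (hq.2 i h1 h2)⟩
    have n1 := hgapY _ _ g1
    have n2 := hgapY _ _ g2
    have hne : z1 ≠ z2 := (hz1.2.trans hz2.1).ne
    have hzero := hz (v - δ • w) (insert z1 (insert z2 (Y.erase (y j)))) (by
      rw [Finset.card_insert_of_notMem, Finset.card_insert_of_notMem, Finset.card_erase_of_mem (hYmem j hj), hYc]
      · omega
      · exact fun h => n2 (Finset.mem_of_mem_erase h)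
      · intro h
        rcases Finset.mem_insert.1 h with h | h
        · exact hne h
        · exact n1 (Finset.mem_of_mem_erase h)) (by
      intro x hx
      rcases Finset.mem_insert.1 hx with rfl | hx
      · exact hz1'
      rcases Finset.mem_insert.1 hx with rfl | hx
      · exact hz2'
      simp only [map_sub, map_smul, Pi.sub_apply, Pi.smul_apply, smul_eq_mul, hw2 x hx,
        hvY x (Finset.mem_of_mem_erase hx)]
      simp)
    rw [hzero] at f1
    simp at f1
  -- reference point
  obtain ⟨p0, hp0⟩ : ∃ p0, InGap y d 0 p0 := by
    rcases Nat.eq_zero_or_pos d with h | h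
    · exact ⟨0, fun i h1 h2 => by omega, fun i h1 h2 => by omega⟩
    · refine ⟨y 0 - 1, fun i h1 h2 => by omega, fun i h1 h2 => ?_⟩
      rcases Nat.eq_zero_or_pos i with rfl | hi
      · linarith
      · have := hlt 0 i hi h2; linarith
  obtain ⟨u, huY, hune, hup⟩ : ∃ u, (∀ x ∈ Y, L u x = 0) ∧ (∀ x, x ∉ Y → L u x ≠ 0) ∧ 0 < L u p0 := by
    rcases lt_or_gt_of_ne (hvne p0 (hgapY _ _ hp0)) with h | h
    · exact ⟨-v, fun x hx => by simp [hvY x hx], fun x hx => by simpa using hvne x hx, by simpa using h⟩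
    · exact ⟨v, hvY, hvne, h⟩
  have main : ∀ j, j ≤ d → ∀ x, InGap y d j x → 0 < (-1) ^ j * L u x := by
    intro j
    induction j with
    | zero =>
      intro _ x hx
      by_contra hcon
      have hxn : L u x < 0 := by
        rw [pow_zero, one_mul, not_lt] at hcon
        exact lt_of_le_of_ne hcon (hune x (hgapY _ _ hx))
      obtain ⟨z, hzm, hz0⟩ := intermediate_value_uIcc (a := x) (b := p0) (hc u).continuousOn
        (show (0:ℝ) ∈ uIcc (L u x) (L u p0) from by rw [uIcc_of_le (hxn.le.trans hup.le)]; exact ⟨hxn.le, hup.le⟩)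
      refine hune z (hgapY z 0 ⟨fun i h1 h2 => by omega, fun i h1 h2 => ?_⟩) hz0
      exact lt_of_le_of_lt hzm.2 (max_lt (hx.2 i h1 h2) (hp0.2 i h1 h2))
    | succ j ih =>
      intro hj x hx
      obtain ⟨p, hp⟩ : ∃ p, InGap y d j p := by
        rcases Nat.eq_zero_or_pos j with h | h
        · subst h; exact ⟨p0, hp0⟩
        · obtain ⟨p, hp⟩ := exists_between (hlt (j - 1) j (by omega) (by omega))
          refine ⟨p, fun i h1 h2 => ?_, fun i h1 h2 => ?_⟩
          · rcases eq_or_lt_of_le (show i ≤ j - 1 by omega) with rfl | h3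
            · exact hp.1
            · exact (hlt i (j - 1) h3 (by omega)).trans hp.1
          · rcases h1.eq_or_lt with rfl | h3
            · exact hp.2
            · exact hp.2.trans (hlt j i h3 h2)
      have h1 := ih (by omega) p hp
      have h2 := hune x (hgapY _ _ hx)
      by_contra hcon
      rw [pow_succ] at hcon
      rcases neg_one_pow_eq_or ℝ j with h | h
      · rw [h] at h1 hcon
        refine hstep u huY j (by omega) p x hp hx (by linarith) (lt_of_le_of_ne (by linarith) h2.symm)
      · rw [h] at h1 hcon
        refine hstep (-u) (fun x hx => by simp [huY x hx]) j (by omega) p x hp hx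
          (by simp; linarith) ?_
        simp
        exact lt_of_le_of_ne (by linarith) h2
  exact ⟨u, fun x j hj hx => main j hj x hx⟩

lemma sep_aux : ∀ (N : ℕ) (A B : Set ℝ) (l : ℝ), IsCompact A → IsCompact B → Disjoint A B →
    (∀ x ∈ A, l < x) →
    (∃ t : ℕ → ℝ, (∀ i < N, t i < t (i + 1)) ∧ ∀ i ≤ N, (Even i → t i ∈ A) ∧ (Odd i → t i ∈ B)) ∨
    ∃ y : ℕ → ℝ, (∀ i < N, l < y i) ∧ (∀ i, i + 1 < N → y i < y (i + 1)) ∧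
      ∀ x ∈ A ∪ B, ∃ j ≤ N, InGap y N j x ∧ (Even j → x ∈ B) ∧ (Odd j → x ∈ A) := by
  intro N
  induction N with
  | zero =>
    intro A B l hA hB hd hl
    rcases A.eq_empty_or_nonempty with h | ⟨x, hx⟩
    · right
      refine ⟨fun _ => 0, fun i hi => by omega, fun i hi => by omega, fun x hx => ⟨0, le_rfl, ?_, ?_, ?_⟩⟩
      · exact ⟨fun i _ h2 => by omega, fun i _ h2 => by omega⟩
      · intro _; rcases hx with hx | hx
        · rw [h] at hx; exact absurd hx (by simp)
        · exact hx
      · intro h; exact absurd h (by decide)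
    · left
      refine ⟨fun _ => x, fun i hi => by omega, fun i hi => ⟨fun _ => hx, fun h => ?_⟩⟩
      have : i = 0 := by omega
      subst this; exact absurd h (by decide)
  | succ N ih =>
    intro A B l hA hB hd hl
    rcases A.eq_empty_or_nonempty with h | hne
    · right
      obtain ⟨K, hK⟩ := hB.bddAbove
      refine ⟨fun i => max l K + 1 + i, fun i hi => ?_, fun i hi => ?_, fun x hx => ⟨0, by omega, ?_, ?_, ?_⟩⟩
      · have := le_max_left l K
        have h2 : (0:ℝ) ≤ i := by positivity
        show l < max l K + 1 + i
        linarith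
      · push_cast; linarith
      · refine ⟨fun i h1 h2 => by omega, fun i h1 h2 => ?_⟩
        have hxB : x ∈ B := by
          rcases hx with hx | hx
          · rw [h] at hx; exact absurd hx (by simp)
          · exact hx
        have := hK hxB
        have h3 := le_max_right l K
        have h2 : (0:ℝ) ≤ i := by positivity
        show x < max l K + 1 + i
        linarith
      · intro _; rcases hx with hx | hx
        · rw [h] at hx; exact absurd hx (by simp)
        · exact hx
      · intro h; exact absurd h (by decide)
    · obtain ⟨a1, ha1, hmin⟩ := hA.exists_isLeast hne
      -- choose y0
      obtain ⟨y0, hy1, hy2, hy3⟩ : ∃ y0, l < y0 ∧ y0 < a1 ∧ ∀ x ∈ B, x < a1 → x < y0 := by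
        have hBc : IsCompact (B ∩ Iic a1) := hB.inter_right isClosed_Iic
        rcases (B ∩ Iic a1).eq_empty_or_nonempty with h | h
        · obtain ⟨y0, h1, h2⟩ := exists_between (hl a1 ha1)
          refine ⟨y0, h1, h2, fun x hx hxa => ?_⟩
          exact absurd (show x ∈ B ∩ Iic a1 from ⟨hx, hxa.le⟩) (by rw [h]; simp)
        · obtain ⟨b, ⟨hb1, hb2⟩, hb3⟩ := hBc.exists_isGreatest h
          have hba : b < a1 := lt_of_le_of_ne hb2 (fun h => by
            subst h; exact Set.disjoint_left.1 hd ha1 hb1)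
          obtain ⟨y0, h1, h2⟩ := exists_between (max_lt (hl a1 ha1) hba)
          refine ⟨y0, (le_max_left _ _).trans_lt h1, h2, fun x hx hxa => ?_⟩
          exact ((hb3 ⟨hx, hxa.le⟩).trans (le_max_right _ _)).trans_lt h1
      rcases ih (B ∩ Ici a1) A y0 (hB.inter_right isClosed_Ici) hA
        (hd.symm.mono_left inter_subset_left) (fun x hx => hy2.trans_le hx.2) with ⟨t, ht1, ht2⟩ | ⟨y, h1, h2, h3⟩
      · left
        refine ⟨fun i => match i with | 0 => a1 | i + 1 => t i, ?_, ?_⟩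
        · intro i hi
          cases i with
          | zero =>
            have := (ht2 0 (by omega)).1 (by decide)
            exact lt_of_le_of_ne this.2 (fun h : a1 = t 0 => Set.disjoint_left.1 hd (h ▸ ha1) this.1)
          | succ i => exact ht1 i (by omega)
        · intro i hi
          cases i with
          | zero => exact ⟨fun _ => ha1, fun h => absurd h (by decide)⟩
          | succ i =>
            refine ⟨fun h => ?_, fun h => ?_⟩
            · exact (ht2 i (by omega)).2 (by rcases Nat.even_or_odd i with h' | h'; (exact absurd h (by simpa [Nat.even_add_one] using h')); exact h')
            · exact ((ht2 i (by omega)).1 (by rcases Nat.even_or_odd i with h' | h'; exact h'; (exact absurd h (by simpa [Nat.odd_add_one] using h')))).1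
      · right
        refine ⟨fun i => match i with | 0 => y0 | i + 1 => y i, ?_, ?_, ?_⟩
        · intro i hi
          cases i with
          | zero => exact hy1
          | succ i => exact hy1.trans (h1 i (by omega))
        · intro i hi
          cases i with
          | zero => exact h1 0 (by omega)
          | succ i => exact h2 i (by omega)
        · intro x hx
          by_cases hxa : a1 ≤ x
          · have hx' : x ∈ B ∩ Ici a1 ∪ A := by
              rcases hx with hx | hx
              · exact Or.inr hx
              · exact Or.inl ⟨hx, hxa⟩
            obtain ⟨j, hj, hg, he, ho⟩ := h3 x hx'
            refine ⟨j + 1, by omega, ⟨fun i h1 h2 => ?_, fun i h1 h2 => ?_⟩, fun h => ?_, fun h => ?_⟩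
            · cases i with
              | zero => exact hy2.trans_le hxa
              | succ i => exact hg.1 i (by omega) (by omega)
            · cases i with
              | zero => omega
              | succ i => exact hg.2 i (by omega) (by omega)
            · exact (ho (by rcases Nat.even_or_odd j with h' | h'; (exact absurd h (by simpa [Nat.even_add_one] using h')); exact h')).1
            · exact (he (by rcases Nat.even_or_odd j with h' | h'; exact h'; (exact absurd h (by simpa [Nat.odd_add_one] using h'))))
          · rw [not_le] at hxa
            have hxB : x ∈ B := by
              rcases hx with hx | hx
              · exact absurd (hmin hx) (not_le.2 hxa)
              · exact hx
            refine ⟨0, by omega, ⟨fun i h1 h2 => by omega, fun i hi1 hi2 => ?_⟩, fun _ => hxB, fun h => absurd h (by decide)⟩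
            cases i with
            | zero => exact hy3 x hxB hxa
            | succ i => exact (hy3 x hxB hxa).trans (h1 i (by omega))

/-- alternation sequence or separators -/
lemma sep_main (N : ℕ) (A B : Set ℝ) (hA : IsCompact A) (hB : IsCompact B) (hd : Disjoint A B) :
    (∃ t : ℕ → ℝ, (∀ i < N + 1, t i < t (i + 1)) ∧ ∀ i ≤ N + 1, (Even i → t i ∈ A) ∧ (Odd i → t i ∈ B)) ∨
    (∃ t : ℕ → ℝ, (∀ i < N + 1, t i < t (i + 1)) ∧ ∀ i ≤ N + 1, (Even i → t i ∈ B) ∧ (Odd i → t i ∈ A)) ∨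
    (∃ y : ℕ → ℝ, (∀ i, i + 1 < N → y i < y (i + 1)) ∧
      ∀ x ∈ A ∪ B, ∃ j ≤ N, InGap y N j x ∧ (Even j → x ∈ B) ∧ (Odd j → x ∈ A)) ∨
    (∃ y : ℕ → ℝ, (∀ i, i + 1 < N → y i < y (i + 1)) ∧
      ∀ x ∈ A ∪ B, ∃ j ≤ N, InGap y N j x ∧ (Even j → x ∈ A) ∧ (Odd j → x ∈ B)) := by
  have key : ∀ (A B : Set ℝ), IsCompact A → IsCompact B → Disjoint A B → 
      (A = ∅ ∨ ∃ p ∈ B, ∀ x ∈ A, p ≤ x) → 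
      (∃ t : ℕ → ℝ, (∀ i < N + 1, t i < t (i + 1)) ∧ ∀ i ≤ N + 1, (Even i → t i ∈ B) ∧ (Odd i → t i ∈ A)) ∨
      (∃ y : ℕ → ℝ, (∀ i, i + 1 < N → y i < y (i + 1)) ∧
      ∀ x ∈ A ∪ B, ∃ j ≤ N, InGap y N j x ∧ (Even j → x ∈ B) ∧ (Odd j → x ∈ A)) := by
    intro A B hA hB hd hp
    obtain ⟨l, hl⟩ := hA.bddBelow
    rcases sep_aux N A B (l - 1) hA hB hd (fun x hx => by have := hl hx; linarith) with ⟨t, ht1, ht2⟩ | ⟨y, h1, h2, h3⟩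
    · left
      have ht0 := (ht2 0 (by omega)).1 (by decide)
      obtain ⟨p, hpB, hpA⟩ : ∃ p ∈ B, ∀ x ∈ A, p ≤ x := by
        rcases hp with h | h
        · rw [h] at ht0; exact absurd ht0 (by simp)
        · exact h
      refine ⟨fun i => match i with | 0 => p | i + 1 => t i, ?_, ?_⟩
      · intro i hi
        cases i with
        | zero =>
          exact lt_of_le_of_ne (hpA _ ht0) (fun h : p = t 0 => Set.disjoint_left.1 hd ht0 (h ▸ hpB))
        | succ i => exact ht1 i (by omega)
      · intro i hi
        cases i with
        | zero => exact ⟨fun _ => hpB, fun h => absurd h (by decide)⟩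
        | succ i =>
          refine ⟨fun h => ?_, fun h => ?_⟩
          · exact (ht2 i (by omega)).2 (by rcases Nat.even_or_odd i with h' | h'; (exact absurd h (by simpa [Nat.even_add_one] using h')); exact h')
          · exact ((ht2 i (by omega)).1 (by rcases Nat.even_or_odd i with h' | h'; exact h'; (exact absurd h (by simpa [Nat.odd_add_one] using h'))))
    · right; exact ⟨y, h2, h3⟩
  rcases (A ∪ B).eq_empty_or_nonempty with h | h
  · have : A = ∅ := by rw [union_empty_iff] at h; exact h.1
    rcases key A B hA hB hd (Or.inl this) with h | h
    · exact Or.inr (Or.inl h)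
    · exact Or.inr (Or.inr (Or.inl h))
  · obtain ⟨p, hp, hpmin⟩ := (hA.union hB).exists_isLeast h
    rcases hp with hp | hp
    · rcases key B A hB hA hd.symm (Or.inr ⟨p, hp, fun x hx => hpmin (Or.inr hx)⟩) with h | ⟨y, h1, h2⟩
      · exact Or.inl h
      · exact Or.inr (Or.inr (Or.inr ⟨y, h1, fun x hx => h2 x (hx.symm)⟩))
    · rcases key A B hA hB hd (Or.inr ⟨p, hp, fun x hx => hpmin (Or.inl hx)⟩) with h | h
      · exact Or.inr (Or.inl h)
      · exact Or.inr (Or.inr (Or.inl h))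

/-- alternation for `G` on `[0,a]` of length `k` -/
def GAlt (G f : ℝ → ℝ) (a M : ℝ) (k : ℕ) (σ : ℝ) (t : ℕ → ℝ) : Prop :=
  (∀ i, i + 1 < k → t i < t (i + 1)) ∧ (∀ i < k, t i ∈ Icc 0 a) ∧ ∀ i < k, G (t i) = σ * (-1) ^ i * (M * f (t i))

lemma sep_G (N : ℕ) {G f : ℝ → ℝ} {a M : ℝ} (hG : Continuous G) (hf : Continuous f) (hfp : ∀ x, 0 < f x) (hM : 0 < M) :
    (∃ σ t, (σ = 1 ∨ σ = -1) ∧ GAlt G f a M (N + 2) σ t) ∨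
    ∃ (σ : ℝ) (y : ℕ → ℝ), (σ = 1 ∨ σ = -1) ∧ (∀ i, i + 1 < N → y i < y (i + 1)) ∧
      ∀ x ∈ Icc 0 a, ∀ s : ℝ, (s = 1 ∨ s = -1) → G x = s * (M * f x) → ∃ j ≤ N, InGap y N j x ∧ s = σ * (-1) ^ j := by
  have hA : IsCompact (Icc 0 a ∩ {x | G x = M * f x}) :=
    isCompact_Icc.inter_right (isClosed_eq hG (continuous_const.mul hf))
  have hB : IsCompact (Icc 0 a ∩ {x | G x = - (M * f x)}) :=
    isCompact_Icc.inter_right (isClosed_eq hG (continuous_const.mul hf).neg)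
  have hd : Disjoint (Icc 0 a ∩ {x | G x = M * f x}) (Icc 0 a ∩ {x | G x = - (M * f x)}) := by
    rw [Set.disjoint_left]
    rintro x ⟨_, h1⟩ ⟨_, h2⟩
    have : 0 < M * f x := mul_pos hM (hfp x)
    simp only [mem_ofPred_eq] at h1 h2
    linarith
  have pe : ∀ i : ℕ, Even i → (-1:ℝ) ^ i = 1 := fun i h => h.neg_one_pow
  have po : ∀ i : ℕ, Odd i → (-1:ℝ) ^ i = -1 := fun i h => h.neg_one_pow
  have neq : ∀ x, G x = M * f x → G x = -(M * f x) → False := fun x h1 h2 => by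
    have : 0 < M * f x := mul_pos hM (hfp x)
    linarith
  rcases sep_main N _ _ hA hB hd with ⟨t, h1, h2⟩ | ⟨t, h1, h2⟩ | ⟨y, h1, h2⟩ | ⟨y, h1, h2⟩
  · refine Or.inl ⟨1, t, Or.inl rfl, fun i hi => h1 i (by omega), fun i hi => ?_, fun i hi => ?_⟩
    · rcases Nat.even_or_odd i with h | h
      · exact ((h2 i (by omega)).1 h).1
      · exact ((h2 i (by omega)).2 h).1
    · rcases Nat.even_or_odd i with h | h
      · rw [pe i h, ((h2 i (by omega)).1 h).2]; ring
      · rw [po i h, ((h2 i (by omega)).2 h).2]; ring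
  · refine Or.inl ⟨-1, t, Or.inr rfl, fun i hi => h1 i (by omega), fun i hi => ?_, fun i hi => ?_⟩
    · rcases Nat.even_or_odd i with h | h
      · exact ((h2 i (by omega)).1 h).1
      · exact ((h2 i (by omega)).2 h).1
    · rcases Nat.even_or_odd i with h | h
      · rw [pe i h, ((h2 i (by omega)).1 h).2]; ring
      · rw [po i h, ((h2 i (by omega)).2 h).2]; ring
  · refine Or.inr ⟨-1, y, Or.inr rfl, h1, fun x hx s hs hG => ?_⟩
    have hm : x ∈ (Icc 0 a ∩ {x | G x = M * f x}) ∪ (Icc 0 a ∩ {x | G x = - (M * f x)}) := by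
      rcases hs with rfl | rfl
      · exact Or.inl ⟨hx, by simpa using hG⟩
      · exact Or.inr ⟨hx, by simpa using hG⟩
    obtain ⟨j, hj, hg, he, ho⟩ := h2 x hm
    refine ⟨j, hj, hg, ?_⟩
    rcases Nat.even_or_odd j with h | h
    · have := (he h).2
      rcases hs with rfl | rfl
      · exact (neq x (by simpa using hG) this).elim
      · rw [pe j h]; ring
    · have := (ho h).2
      rcases hs with rfl | rfl
      · rw [po j h]; ring
      · exact (neq x this (by simpa using hG)).elim
  · refine Or.inr ⟨1, y, Or.inl rfl, h1, fun x hx s hs hG => ?_⟩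
    have hm : x ∈ (Icc 0 a ∩ {x | G x = M * f x}) ∪ (Icc 0 a ∩ {x | G x = - (M * f x)}) := by
      rcases hs with rfl | rfl
      · exact Or.inl ⟨hx, by simpa using hG⟩
      · exact Or.inr ⟨hx, by simpa using hG⟩
    obtain ⟨j, hj, hg, he, ho⟩ := h2 x hm
    refine ⟨j, hj, hg, ?_⟩
    rcases Nat.even_or_odd j with h | h
    · have := (he h).2
      rcases hs with rfl | rfl
      · rw [pe j h]; ring
      · exact (neq x this (by simpa using hG)).elim
    · have := (ho h).2
      rcases hs with rfl | rfl
      · exact (neq x (by simpa using hG) this).elim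
      · rw [po j h]; ring

noncomputable def gam (x : ℝ) : ℝ := (1 / Real.sqrt Real.pi) * Real.exp (-1 * x ^ 2)

noncomputable def Phi (x : ℝ) : ℝ := 1 / 2 + ∫ s in (0:ℝ)..x, gam s

lemma gam_cont : Continuous gam := by unfold gam; fun_prop

lemma gam_pos (x : ℝ) : 0 < gam x := by
  unfold gam
  have := Real.pi_pos
  positivity

lemma gam_le (x : ℝ) : gam x ≤ 1 := by
  unfold gam
  have h1 : 1 ≤ Real.sqrt Real.pi := by
    rw [Real.one_le_sqrt]; have := Real.pi_gt_three; linarith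
  have h2 : Real.exp (-1 * x ^ 2) ≤ 1 := by
    rw [Real.exp_le_one_iff]; nlinarith [sq_nonneg x]
  have h3 : 1 / Real.sqrt Real.pi ≤ 1 := by
    rw [div_le_one (by linarith)]; exact h1
  calc _ ≤ (1:ℝ) * 1 := mul_le_mul h3 h2 (Real.exp_pos _).le zero_le_one
    _ = 1 := one_mul 1

lemma Phi_deriv (x : ℝ) : HasDerivAt Phi (gam x) x :=
  (intervalIntegral.integral_hasDerivAt_right (gam_cont.intervalIntegrable _ _)
    (gam_cont.stronglyMeasurableAtFilter _ _) gam_cont.continuousAt).const_add _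

lemma Phi_cont : Continuous Phi :=
  continuous_iff_continuousAt.2 fun x => (Phi_deriv x).continuousAt

lemma Phi_neg (x : ℝ) : Phi (-x) = 1 - Phi x := by
  unfold Phi
  have h := intervalIntegral.integral_comp_neg (a := 0) (b := x) gam
  have h2 : ∀ s, gam (-s) = gam s := fun s => by unfold gam; simp
  simp only [h2, neg_zero] at h
  rw [intervalIntegral.integral_symm, h] 
  ring

lemma Phi_mono : StrictMono Phi := by
  apply strictMono_of_deriv_pos
  intro x
  rw [(Phi_deriv x).deriv]; exact gam_pos x

lemma Phi_top : Tendsto Phi atTop (𝓝 1) := by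
  have hi : IntegrableOn gam (Ioi 0) :=
    ((integrable_exp_neg_mul_sq (b := 1) one_pos).const_mul _).integrableOn
  have h := intervalIntegral_tendsto_integral_Ioi (μ := volume) (f := gam) (b := fun x : ℝ => x) 0 hi tendsto_id
  have h2 : ∫ x in Ioi (0:ℝ), gam x = 1 / 2 := by
    unfold gam
    rw [integral_const_mul, integral_gaussian_Ioi]
    have : Real.sqrt Real.pi ≠ 0 := (Real.sqrt_pos.2 Real.pi_pos).ne'
    rw [div_one]; field_simp
  rw [h2] at h
  have := h.const_add (1 / 2 : ℝ)
  have e : (1 / 2 : ℝ) + 1 / 2 = 1 := by norm_num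
  rw [e] at this
  exact this

lemma Phi_bot : Tendsto Phi atBot (𝓝 0) := by
  have h := (Phi_top.comp tendsto_neg_atBot_atTop).const_sub 1
  simp only [sub_self] at h
  refine h.congr fun x => ?_
  simp [Phi_neg]

lemma Phi_le_one (x : ℝ) : Phi x ≤ 1 := Phi_mono.monotone.ge_of_tendsto Phi_top x
lemma Phi_nonneg (x : ℝ) : 0 ≤ Phi x := Phi_mono.monotone.le_of_tendsto Phi_bot x

lemma Phi_lip (x y : ℝ) : |Phi x - Phi y| ≤ |x - y| := by
  have := Convex.norm_image_sub_le_of_norm_hasDerivWithin_le (f := Phi) (f' := gam) (C := 1) (s := univ) (x := y) (y := x)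
    (fun z _ => (Phi_deriv z).hasDerivWithinAt) (fun z _ => by
      rw [Real.norm_eq_abs, abs_of_pos (gam_pos z)]; exact gam_le z) convex_univ trivial trivial
  simpa using this

lemma gam_factor (l z s : ℝ) : gam (l * (s - z)) =
    (1 / Real.sqrt Real.pi * Real.exp (-(l ^ 2 * s ^ 2))) * (Real.exp (-(l ^ 2 * z ^ 2)) * Real.exp (2 * l ^ 2 * z * s)) := by
  unfold gam
  rw [mul_assoc, ← Real.exp_add, ← Real.exp_add]
  congr 2; ring

lemma gsum_factor (l : ℝ) (M : ℕ) (b ζ : ℕ → ℝ) (s : ℝ) :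
    ∑ i ∈ Finset.range M, b i * gam (l * (s - ζ i)) =
    (1 / Real.sqrt Real.pi * Real.exp (-(l ^ 2 * s ^ 2))) *
      ∑ i ∈ Finset.range M, (b i * Real.exp (-(l ^ 2 * ζ i ^ 2))) * Real.exp (2 * l ^ 2 * ζ i * s) := by
  rw [Finset.mul_sum]
  refine Finset.sum_congr rfl fun i _ => ?_
  rw [gam_factor]; ring

lemma fac_pos (l s : ℝ) : 0 < (1 / Real.sqrt Real.pi * Real.exp (-(l ^ 2 * s ^ 2))) := by
  have := Real.pi_pos
  positivity

lemma gsum_sign {l : ℝ} (hl : 0 < l) (M : ℕ) (b ζ : ℕ → ℝ) (σ : ℝ) (hζ : ∀ i < M, ζ i < ζ (i + 1))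
    (h : AltP (fun s => ∑ i ∈ Finset.range (M + 1), b i * gam (l * (s - ζ i))) (M + 1) σ) : 0 < σ * b 0 := by
  have h2 := h.congr_pos (H := fun s => ∑ i ∈ Finset.range (M + 1), (b i * Real.exp (-(l ^ 2 * ζ i ^ 2))) * Real.exp (2 * l ^ 2 * ζ i * s))
    (fac_pos l) (fun s => gsum_factor l (M + 1) b ζ s)
  have h3 := expsum_sign M (fun i => (b i * Real.exp (-(l ^ 2 * ζ i ^ 2)))) (fun i => 2 * l ^ 2 * ζ i) σ
    (fun i hi => by have := hζ i hi; gcongr) h2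
  have h4 : 0 < Real.exp (-(l ^ 2 * ζ 0 ^ 2)) := Real.exp_pos _
  rw [← mul_assoc] at h3
  exact pos_of_mul_pos_left h3 h4.le

lemma gsum_zero {l : ℝ} (hl : 0 < l) (M : ℕ) (b ζ : ℕ → ℝ) (hζ : ∀ i, i + 1 < M → ζ i < ζ (i + 1))
    (h : ZeroP (fun s => ∑ i ∈ Finset.range M, b i * gam (l * (s - ζ i))) M) : ∀ i < M, b i = 0 := by
  obtain ⟨s, h1, h2⟩ := h
  have h3 := expsum_zero M (fun i => (b i * Real.exp (-(l ^ 2 * ζ i ^ 2)))) (fun i => 2 * l ^ 2 * ζ i)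
    (fun i hi => by have := hζ i hi; gcongr) ⟨s, h1, fun i hi => by
      have := h2 i hi
      simp only at this
      rw [gsum_factor] at this
      exact (mul_eq_zero.1 this).resolve_left (fac_pos _ _).ne'⟩
  intro i hi
  exact (mul_eq_zero.1 (h3 i hi)).resolve_right (Real.exp_pos _).ne'

/-- the (smoothed) sign function -/
noncomputable def hh (θ : ℝ → ℝ) (a : ℝ) (m : ℕ) (ε : ℝ) (ξ : ℕ → ℝ) (s : ℝ) : ℝ :=
  ε * (θ s + 2 * ∑ i ∈ Finset.range m, (-1) ^ (i + 1) * θ (s - ξ i) + (-1) ^ (m + 1) * θ (s - a))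

/-- all knots with endpoints -/
def zk (a : ℝ) (m : ℕ) (ξ : ℕ → ℝ) : ℕ → ℝ
  | 0 => 0
  | i + 1 => if i < m then ξ i else a

def qk (m : ℕ) : ℕ → ℝ
  | 0 => 1
  | i + 1 => if i < m then 2 * (-1) ^ (i + 1) else (-1) ^ (i + 1)

lemma hh_eq (θ : ℝ → ℝ) (a : ℝ) (m : ℕ) (ε : ℝ) (ξ : ℕ → ℝ) (s : ℝ) :
    hh θ a m ε ξ s = ∑ i ∈ Finset.range (m + 2), ε * qk m i * θ (s - zk a m ξ i) := by
  rw [Finset.sum_range_succ', Finset.sum_range_succ]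
  have : ∑ x ∈ Finset.range m, ε * qk m (x + 1) * θ (s - zk a m ξ (x + 1)) =
      ∑ x ∈ Finset.range m, ε * 2 * ((-1) ^ (x + 1) * θ (s - ξ x)) := by
    refine Finset.sum_congr rfl fun i hi => ?_
    simp only [qk, zk, Finset.mem_range.1 hi, if_true]; ring
  rw [this, ← Finset.mul_sum]
  simp only [qk, zk, lt_irrefl, if_false, sub_zero, hh]
  ring

/-- strict knots -/
def SKn (a : ℝ) (m : ℕ) (ξ : ℕ → ℝ) : Prop :=
  (∀ i < m, ξ i ∈ Ioo 0 a) ∧ ∀ i, i + 1 < m → ξ i < ξ (i + 1)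

lemma zk_strict {a : ℝ} {m : ℕ} {ξ : ℕ → ℝ} (ha : 0 < a) (h : SKn a m ξ) : ∀ i < m + 1, zk a m ξ i < zk a m ξ (i + 1) := by
  intro i hi
  cases i with
  | zero =>
    simp only [zk]
    split_ifs with h0
    · exact (h.1 0 h0).1
    · exact ha
  | succ i =>
    simp only [zk]
    rw [if_pos (by omega)]
    split_ifs with h0
    · exact h.2 i h0
    · exact (h.1 i (by omega)).2

noncomputable def thl (l : ℝ) (x : ℝ) : ℝ := Phi (l * x)

lemma qsum (m : ℕ) : ∑ i ∈ Finset.range (m + 2), qk m i = 0 := by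
  have h := hh_eq (fun _ => 1) 0 m 1 (fun _ => 0) 0
  simp only [mul_one, one_mul] at h
  rw [← h]
  simp only [hh, mul_one, one_mul]
  induction m with
  | zero => simp
  | succ m ih =>
    have ih' := ih (by rw [hh_eq]; simp)
    rw [Finset.sum_range_succ]
    rw [pow_succ (-1 : ℝ) (m + 1)]
    linarith

lemma hh_deriv (l a : ℝ) (m : ℕ) (ε : ℝ) (ξ : ℕ → ℝ) (s : ℝ) :
    HasDerivAt (hh (thl l) a m ε ξ)
      (∑ i ∈ Finset.range (m + 2), (ε * qk m i * l) * gam (l * (s - zk a m ξ i))) s := by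
  have h : hh (thl l) a m ε ξ = fun s => ∑ i ∈ Finset.range (m + 2), ε * qk m i * thl l (s - zk a m ξ i) := by
    funext s; exact hh_eq _ _ _ _ _ _
  rw [h]
  apply HasDerivAt.fun_sum
  intro i _
  have h1 : HasDerivAt (fun s => l * (s - zk a m ξ i)) (l * 1) s := ((hasDerivAt_id s).sub_const _).const_mul l
  have h2 := ((Phi_deriv (l * (s - zk a m ξ i))).comp s h1).const_mul (ε * qk m i)
  refine h2.congr_deriv ?_
  ring

lemma hh_top {l : ℝ} (hl : 0 < l) (a : ℝ) (m : ℕ) (ε : ℝ) (ξ : ℕ → ℝ) : Tendsto (hh (thl l) a m ε ξ) atTop (𝓝 0) := by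
  have h : hh (thl l) a m ε ξ = fun s => ∑ i ∈ Finset.range (m + 2), ε * qk m i * thl l (s - zk a m ξ i) := by
    funext s; exact hh_eq _ _ _ _ _ _
  rw [h]
  have h2 : Tendsto (fun s => ∑ i ∈ Finset.range (m + 2), ε * qk m i * thl l (s - zk a m ξ i)) atTop
      (𝓝 (∑ i ∈ Finset.range (m + 2), ε * qk m i * 1)) := by
    apply tendsto_finsetSum
    intro i _
    apply Tendsto.const_mul
    apply Phi_top.comp
    exact (tendsto_atTop_add_const_right _ (-zk a m ξ i) tendsto_id).const_mul_atTop hl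
  convert h2
  simp only [mul_one]
  rw [← Finset.mul_sum, qsum, mul_zero]

lemma hh_bot {l : ℝ} (hl : 0 < l) (a : ℝ) (m : ℕ) (ε : ℝ) (ξ : ℕ → ℝ) : Tendsto (hh (thl l) a m ε ξ) atBot (𝓝 0) := by
  have h : hh (thl l) a m ε ξ = fun s => ∑ i ∈ Finset.range (m + 2), ε * qk m i * thl l (s - zk a m ξ i) := by
    funext s; exact hh_eq _ _ _ _ _ _
  rw [h]
  have h2 : Tendsto (fun s => ∑ i ∈ Finset.range (m + 2), ε * qk m i * thl l (s - zk a m ξ i)) atBot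
      (𝓝 (∑ i ∈ Finset.range (m + 2), ε * qk m i * 0)) := by
    apply tendsto_finsetSum
    intro i _
    apply Tendsto.const_mul
    apply Phi_bot.comp
    exact (tendsto_atBot_add_const_right _ (-zk a m ξ i) tendsto_id).const_mul_atBot hl
  convert h2
  simp

lemma alt_ext {F : ℝ → ℝ} (h1 : Tendsto F atTop (𝓝 0)) (h2 : Tendsto F atBot (𝓝 0)) {k : ℕ} {σ : ℝ}
    (h : AltP F (k + 1) σ) : IncAlt F (k + 2) σ := by
  obtain ⟨s, hs1, hs2⟩ := h
  have A0 := hs2 0 (by omega)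
  have Ak := hs2 k (by omega)
  rw [pow_zero] at A0
  have t1 : ∀ᶠ x in atBot, σ * F x < σ * F (s 0) := by
    have : Tendsto (fun x => σ * F x) atBot (𝓝 (σ * 0)) := h2.const_mul σ
    exact this.eventually (gt_mem_nhds (by linarith))
  have t2 : ∀ᶠ x in atTop, σ * (-1) ^ k * F x < σ * (-1) ^ k * F (s k) := by
    have : Tendsto (fun x => σ * (-1) ^ k * F x) atTop (𝓝 (σ * (-1) ^ k * 0)) := h1.const_mul _
    exact this.eventually (gt_mem_nhds (by linarith))
  obtain ⟨x, hx1, hx2⟩ := (t1.and (eventually_lt_atBot (s 0))).exists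
  obtain ⟨y, hy1, hy2⟩ := (t2.and (eventually_gt_atTop (s k))).exists
  refine ⟨fun i => match i with | 0 => x | i + 1 => if i ≤ k then s i else y, ?_, ?_⟩
  · intro i hi
    rcases i with _ | i
    · simpa using hx2
    · simp only
      rw [if_pos (by omega)]
      split_ifs with h
      · exact hs1 i (by omega)
      · have : i = k := by omega
        subst this; exact hy2
  · intro i hi
    rcases i with _ | i
    · simp; linarith
    · simp only
      rw [if_pos (show i ≤ k by omega)]
      split_ifs with h
      · have a := hs2 i (by omega)
        have b := hs2 (i + 1) (by omega)
        rw [pow_succ] at b ⊢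
        linarith
      · have : i = k := by omega
        subst this
        rw [pow_succ]; linarith

lemma H2 {l a : ℝ} (hl : 0 < l) (ha : 0 < a) {m : ℕ} {ε : ℝ} {ξ : ℕ → ℝ} (h : SKn a m ξ) {σ : ℝ}
    (hA : AltP (hh (thl l) a m ε ξ) (m + 1) σ) : 0 < σ * ε := by
  have h1 := (alt_ext (hh_top hl a m ε ξ) (hh_bot hl a m ε ξ) hA).deriv (hh_deriv l a m ε ξ)
  have h2 := gsum_sign hl (m + 1) _ _ σ (zk_strict ha h) h1
  simp only [qk, mul_one] at h2
  rw [← mul_assoc] at h2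
  exact pos_of_mul_pos_left h2 hl.le

lemma H1 {l a : ℝ} (hl : 0 < l) (ha : 0 < a) {m : ℕ} {ε : ℝ} {ξ : ℕ → ℝ} (h : SKn a m ξ) {σ : ℝ}
    (hA : AltP (hh (thl l) a m ε ξ) (m + 2) σ) : False := by
  have h1 := H2 hl ha h (hA.mono (l := m + 1) (by omega))
  have h2 := H2 hl ha h hA.tail
  linarith

def Valid (a : ℝ) (m : ℕ) (ξ : ℕ → ℝ) : Prop :=
  (∀ i, ξ i ∈ Icc 0 a) ∧ ∀ i, i + 1 < m → ξ i ≤ ξ (i + 1)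

lemma red_step {a : ℝ} {m : ℕ} {ε : ℝ} {ξ : ℕ → ℝ} (hV : Valid a m ξ) (hε : ε = 1 ∨ ε = -1) (hS : ¬ SKn a m ξ) :
    ∃ m' < m, ∃ ε' ξ', (ε' = 1 ∨ ε' = -1) ∧ Valid a m' ξ' ∧ ∀ (θ : ℝ → ℝ) s, hh θ a m ε ξ s = hh θ a m' ε' ξ' s := by
  have hmono : ∀ i j, i ≤ j → j < m → ξ i ≤ ξ j := by
    intro i j hij
    induction j with
    | zero => intro _; have : i = 0 := by omega
              rw [this]
    | succ j ih =>
      intro hj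
      rcases Nat.le_succ_iff.1 hij with h | h
      · exact (ih h (by omega)).trans (hV.2 j hj)
      · rw [h]
  by_cases h1 : ∃ i, i + 1 < m ∧ ξ i = ξ (i + 1)
  · obtain ⟨i, hi, he⟩ := h1
    obtain ⟨k, rfl⟩ : ∃ k, m = i + 2 + k := ⟨m - (i + 2), by omega⟩
    refine ⟨i + k, by omega, ε, fun j => if j < i then ξ j else ξ (j + 2), hε, ⟨fun j => ?_, fun j hj => ?_⟩, fun θ s => ?_⟩
    · simp only; split_ifs <;> exact hV.1 _
    · simp only; split_ifs with h1 h2 h2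
      · exact hV.2 j (by omega)
      · exact hmono _ _ (by omega) (by omega)
      · omega
      · exact hV.2 (j + 2) (by omega)
    · unfold hh
      rw [Finset.sum_range_add, Finset.sum_range_add _ i k, Finset.sum_range_succ, Finset.sum_range_succ]
      have e1 : ∑ x ∈ Finset.range i, (-1 : ℝ) ^ (x + 1) * θ (s - if x < i then ξ x else ξ (x + 2)) =
          ∑ x ∈ Finset.range i, (-1 : ℝ) ^ (x + 1) * θ (s - ξ x) :=
        Finset.sum_congr rfl fun x hx => by rw [if_pos (Finset.mem_range.1 hx)]
      have e2 : ∑ x ∈ Finset.range k, (-1 : ℝ) ^ (i + x + 1) * θ (s - if i + x < i then ξ (i + x) else ξ (i + x + 2)) =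
          ∑ x ∈ Finset.range k, (-1 : ℝ) ^ (i + 2 + x + 1) * θ (s - ξ (i + 2 + x)) :=
        Finset.sum_congr rfl fun x hx => by
          rw [if_neg (by omega), show i + 2 + x + 1 = i + x + 1 + 2 by ring, pow_add _ _ 2,
            show i + 2 + x = i + x + 2 by ring]; simp
      rw [e1, e2, he, show i + 2 + k + 1 = i + k + 1 + 2 by ring, pow_add _ (i + k + 1) 2, pow_succ _ (i + 1)]
      ring
  · push Not at h1
    have hlt : ∀ i, i + 1 < m → ξ i < ξ (i + 1) := fun i hi => lt_of_le_of_ne (hV.2 i hi) (h1 i hi)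
    have hm : 0 < m := by
      by_contra h0
      exact hS ⟨fun i hi => by omega, hlt⟩
    obtain ⟨k, rfl⟩ : ∃ k, m = k + 1 := ⟨m - 1, by omega⟩
    by_cases h0 : ξ 0 = 0
    · refine ⟨k, by omega, -ε, fun j => ξ (j + 1), by rcases hε with rfl | rfl <;> simp,
        ⟨fun j => hV.1 _, fun j hj => hV.2 _ (by omega)⟩, fun θ s => ?_⟩
      unfold hh
      rw [Finset.sum_range_succ']
      have e2 : ∑ x ∈ Finset.range k, (-1 : ℝ) ^ (x + 1 + 1) * θ (s - ξ (x + 1)) =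
        - ∑ x ∈ Finset.range k, (-1 : ℝ) ^ (x + 1) * θ (s - ξ (x + 1)) := by
        rw [← Finset.sum_neg_distrib]
        exact Finset.sum_congr rfl fun x _ => by rw [pow_succ _ (x + 1)]; ring
      rw [e2, h0, sub_zero, pow_succ _ (k + 1)]
      ring
    · by_cases hka : ξ k = a
      · refine ⟨k, by omega, ε, ξ, hε, ⟨hV.1, fun j hj => hV.2 j (by omega)⟩, fun θ s => ?_⟩
        unfold hh
        rw [Finset.sum_range_succ, hka, pow_succ _ (k + 1)]
        ring
      · exfalso
        apply hS
        refine ⟨fun i hi => ⟨?_, ?_⟩, hlt⟩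
        · exact lt_of_lt_of_le (lt_of_le_of_ne (hV.1 0).1 (Ne.symm h0)) (hmono 0 i (by omega) hi)
        · exact lt_of_le_of_lt (hmono i k (by omega) (by omega)) (lt_of_le_of_ne (hV.1 k).2 hka)

lemma red {a : ℝ} : ∀ (m : ℕ) (ε : ℝ) (ξ : ℕ → ℝ), Valid a m ξ → (ε = 1 ∨ ε = -1) →
    ∃ m' ≤ m, ∃ ε' ξ', (ε' = 1 ∨ ε' = -1) ∧ Valid a m' ξ' ∧ SKn a m' ξ' ∧
      ∀ (θ : ℝ → ℝ) s, hh θ a m ε ξ s = hh θ a m' ε' ξ' s := by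
  intro m
  induction m using Nat.strong_induction_on with
  | _ m ih =>
    intro ε ξ hV hε
    by_cases hS : SKn a m ξ
    · exact ⟨m, le_rfl, ε, ξ, hε, hV, hS, fun _ _ => rfl⟩
    · obtain ⟨m1, hm1, ε1, ξ1, hε1, hV1, e1⟩ := red_step hV hε hS
      obtain ⟨m2, hm2, ε2, ξ2, hε2, hV2, hS2, e2⟩ := ih m1 hm1 ε1 ξ1 hV1 hε1
      exact ⟨m2, by omega, ε2, ξ2, hε2, hV2, hS2, fun θ s => (e1 θ s).trans (e2 θ s)⟩

lemma hh_bound {θ : ℝ → ℝ} (hθ : ∀ x, |θ x| ≤ 1) {a : ℝ} {m : ℕ} {ε : ℝ} {ξ : ℕ → ℝ} (hε : ε = 1 ∨ ε = -1) (s : ℝ) :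
    |hh θ a m ε ξ s| ≤ 2 * m + 2 := by
  have h1 : |ε| = 1 := by rcases hε with rfl | rfl <;> simp
  have pw : ∀ (i : ℕ) (x : ℝ), |(-1) ^ i * x| = |x| := fun i x => by rw [abs_mul, abs_pow]; simp
  unfold hh
  rw [abs_mul, h1, one_mul]
  refine (abs_add_le _ _).trans ?_
  rw [pw]
  have h2 : |2 * ∑ i ∈ Finset.range m, (-1) ^ (i + 1) * θ (s - ξ i)| ≤ 2 * m := by
    rw [abs_mul, abs_two]
    have : |∑ i ∈ Finset.range m, (-1) ^ (i + 1) * θ (s - ξ i)| ≤ m := by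
      refine (Finset.abs_sum_le_sum_abs _ _).trans ?_
      refine (Finset.sum_le_sum (g := fun _ => (1:ℝ)) fun i _ => by rw [pw]; exact hθ _).trans ?_
      simp
    linarith
  have h3 := abs_add_le (θ s) (2 * ∑ i ∈ Finset.range m, (-1) ^ (i + 1) * θ (s - ξ i))
  have h4 := hθ s
  have h5 := hθ (s - a)
  linarith

lemma PP_tendsto {ι : Type*} {F : Filter ι} [F.IsCountablyGenerated] {r : ℕ} (hr : 1 ≤ r) {a B : ℝ} (ha : 0 ≤ a)
    {c : ι → ℕ → ℝ} {c0 : ℕ → ℝ} {w : ι → ℝ → ℝ} {w0 : ℝ → ℝ}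
    (hw : ∀ᶠ k in F, LI (w k)) (hw0 : LI w0) (hc : ∀ j < r, Tendsto (fun k => c k j) F (𝓝 (c0 j)))
    (hB : ∀ᶠ k in F, ∀ s ∈ Icc 0 a, |w k s - w0 s| ≤ B)
    (hlim : ∀ᵐ s, s ∈ Icc 0 a → Tendsto (fun k => w k s) F (𝓝 (w0 s))) {η : ℝ} (hη : 0 < η) :
    ∀ᶠ k in F, ∀ t ∈ Icc 0 a, |PP (c k) (w k) r t - PP c0 w0 r t| ≤ η := by
  obtain ⟨q, rfl⟩ : ∃ q, r = q + 1 := ⟨r - 1, by omega⟩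
  set K := (1 + a) ^ q with hK
  have hK0 : 0 < K := by positivity
  set η' := η / (2 * K) with hη'
  have hp : 0 < η' := by positivity
  have h1 : ∀ᶠ k in F, ∀ j ∈ Finset.range (q + 1), |c k j - c0 j| ≤ η' := by
    rw [Filter.eventually_all_finset]
    intro j hj
    have := (hc j (Finset.mem_range.1 hj)).sub_const (c0 j)
    rw [sub_self] at this
    have := this.abs
    rw [abs_zero] at this
    exact (this.eventually (gt_mem_nhds hp)).mono fun k hk => hk.le
  have h2 : Tendsto (fun k => ∫ s in (0:ℝ)..a, |w k s - w0 s|) F (𝓝 (∫ s in (0:ℝ)..a, (0:ℝ))) := by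
    apply intervalIntegral.tendsto_integral_filter_of_dominated_convergence (fun _ => B)
    · filter_upwards [hw] with k hk
      rw [uIoc_of_le ha]
      exact (((hk 0 a).sub (hw0 0 a)).abs).1.aestronglyMeasurable
    · filter_upwards [hB] with k hk
      refine Eventually.of_forall fun s hs => ?_
      rw [uIoc_of_le ha] at hs
      rw [Real.norm_eq_abs, abs_abs]
      exact hk s ⟨hs.1.le, hs.2⟩
    · exact intervalIntegrable_const
    · filter_upwards [hlim] with s hs hs2
      rw [uIoc_of_le ha] at hs2
      have := ((hs ⟨hs2.1.le, hs2.2⟩).sub_const (w0 s)).abs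
      simpa using this
  rw [intervalIntegral.integral_zero] at h2
  have h3 := h2.eventually (gt_mem_nhds hp)
  filter_upwards [h1, h3, hw] with k hk1 hk2 hk3 t ht
  have e := PP_lin (c := c k) (d := c0) hk3 hw0 (-1) (q + 1) t
  have e' : PP (c k) (w k) (q + 1) t - PP c0 w0 (q + 1) t =
      PP (fun j => if j < q + 1 then c k j + (-1) * c0 j else 0) (fun s => w k s + (-1) * w0 s) (q + 1) t := by
    rw [PP_congr (c := fun j => if j < q + 1 then c k j + (-1) * c0 j else 0) (d := fun j => c k j + (-1) * c0 j) (q + 1) (fun j hj => by simp [hj]) t, e]; ring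
  rw [e']
  have hb := PP_bound (c := fun j => if j < q + 1 then c k j + (-1) * c0 j else 0) (w := fun s => w k s + (-1) * w0 s)
    (a := a) (D := η') (I := η') (fun x y => (hk3 x y).add ((hw0 x y).const_mul (-1))) ha (fun j => by
      split_ifs with h
      · have := hk1 j (Finset.mem_range.2 h)
        rwa [neg_one_mul, ← sub_eq_add_neg]
      · simpa using hp.le) (by
      have : (fun s => |w k s + -1 * w0 s|) = fun s => |w k s - w0 s| := by
        funext s; rw [neg_one_mul, ← sub_eq_add_neg]
      rw [this]; exact hk2.le) q t ht
  refine hb.trans (le_of_eq ?_)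
  rw [← hK, hη']; field_simp; ring

noncomputable def Sp (θ g : ℝ → ℝ) (a : ℝ) (r m : ℕ) (ε : ℝ) (ξ c : ℕ → ℝ) : ℝ → ℝ :=
  PP c (fun s => g s * hh θ a m ε ξ s) r

lemma extc_add {r : ℕ} (c d : Fin r → ℝ) (j : ℕ) : extc (c + d) j = extc c j + 1 * extc d j := by
  unfold extc; split_ifs <;> simp

lemma extc_smul {r : ℕ} (t : ℝ) (d : Fin r → ℝ) (j : ℕ) : extc (t • d) j = 0 + t * extc d j := by
  unfold extc; split_ifs <;> simp

lemma PP_zero_zero (k : ℕ) (t : ℝ) : PP (fun _ => 0) (fun _ => 0) k t = 0 := by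
  induction k generalizing t with
  | zero => rfl
  | succ k ih => rw [PP_succ]; simp [ih]

lemma gsum_cont (l : ℝ) (M : ℕ) (b ζ : ℕ → ℝ) : Continuous (fun s => ∑ i ∈ Finset.range M, b i * gam (l * (s - ζ i))) := by
  have := gam_cont
  fun_prop

lemma LI_gsum {g : ℝ → ℝ} (hg : Continuous g) (l : ℝ) (M : ℕ) (b ζ : ℕ → ℝ) :
    LI (fun s => g s * ∑ i ∈ Finset.range M, b i * gam (l * (s - ζ i))) :=
  LI.of_cont (hg.mul (gsum_cont _ _ _ _))

lemma hh_cont (l a : ℝ) (m : ℕ) (ε : ℝ) (ξ : ℕ → ℝ) : Continuous (hh (thl l) a m ε ξ) :=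
  continuous_iff_continuousAt.2 fun s => (hh_deriv l a m ε ξ s).continuousAt

lemma LI_hh {g : ℝ → ℝ} (hg : Continuous g) (l a : ℝ) (m : ℕ) (ε : ℝ) (ξ : ℕ → ℝ) :
    LI (fun s => g s * hh (thl l) a m ε ξ s) :=
  LI.of_cont (hg.mul (hh_cont _ _ _ _ _))

noncomputable def Lhaar (g : ℝ → ℝ) (hg : Continuous g) (l : ℝ) (r M : ℕ) (ζ : ℕ → ℝ) :
    ((Fin r → ℝ) × (Fin M → ℝ)) →ₗ[ℝ] (ℝ → ℝ) where
  toFun v := PP (extc v.1) (fun s => g s * ∑ i ∈ Finset.range M, extc v.2 i * gam (l * (s - ζ i))) r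
  map_add' u v := by
    funext t
    rw [Pi.add_apply, ← one_mul (PP (extc v.1) _ r t), ← PP_lin (LI_gsum hg _ _ _ _)
      (LI_gsum hg _ _ _ _)]
    congr 1
    · funext j; exact extc_add _ _ _
    · funext s
      rw [one_mul, ← mul_add, ← Finset.sum_add_distrib]
      congr 1
      refine Finset.sum_congr rfl fun i _ => ?_
      rw [Prod.snd_add, extc_add]; ring
  map_smul' x v := by
    funext t
    simp only [RingHom.id_apply, Pi.smul_apply, smul_eq_mul]
    rw [← zero_add (x * _), ← PP_zero_zero r t, ← PP_lin (w := fun _ => 0) (LI.of_cont continuous_const)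
      (LI_gsum hg _ _ _ _)]
    congr 1
    · funext j; exact extc_smul _ _ _
    · funext s
      rw [zero_add, ← mul_assoc, mul_comm x, mul_assoc]
      congr 1
      rw [Finset.mul_sum]
      apply Finset.sum_congr rfl
      intro i _
      rw [Prod.smul_snd, extc_smul]; ring

lemma haar_spline {g : ℝ → ℝ} (hg : Continuous g) (hgp : ∀ x, 0 < g x) {l : ℝ} (hl : 0 < l) {r M N : ℕ}
    (hN : N + 1 = M + r) {ζ : ℕ → ℝ} (hζ : ∀ i, i + 1 < M → ζ i < ζ (i + 1))
    {y : ℕ → ℝ} (hy : ∀ i, i + 1 < N → y i < y (i + 1)) :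
    ∃ d b : ℕ → ℝ, ∀ x, ∀ j ≤ N, InGap y N j x →
      0 < (-1) ^ j * PP d (fun s => g s * ∑ i ∈ Finset.range M, b i * gam (l * (s - ζ i))) r x := by
  have hcw : ∀ b : ℕ → ℝ, Continuous (fun s => g s * ∑ i ∈ Finset.range M, b i * gam (l * (s - ζ i))) :=
    fun b => hg.mul (gsum_cont _ _ _ _)
  obtain ⟨v, hv⟩ := haar_sign (Lhaar g hg l r M ζ) N (by
      rw [Module.finrank_prod, Module.finrank_fintype_fun_eq_card, Module.finrank_fintype_fun_eq_card]
      simp; omega) (fun v => PP_cont' (hcw _) r) (by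
      rintro ⟨c, b⟩ S hS hz
      have hS' : S.card = M + r := by omega
      have Z : ZeroP (PP (extc c) (fun s => g s * ∑ i ∈ Finset.range M, extc b i * gam (l * (s - ζ i))) r) (M + r) := by
        refine ⟨fun i => if h : i < M + r then S.orderEmbOfFin hS' ⟨i, h⟩ else 0, fun i hi => ?_, fun i hi => ?_⟩
        · simp only
          rw [dif_pos hi, dif_pos (by omega)]
          apply (S.orderEmbOfFin hS').strictMono
          simp
        · simp only
          rw [dif_pos hi]
          exact hz _ (S.orderEmbOfFin_mem hS' _)
      obtain ⟨s, hs1, hs2⟩ := PP_zero (hcw _) M r Z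
      have hb := gsum_zero hl M (extc b) ζ hζ ⟨s, hs1, fun i hi =>
        (mul_eq_zero.1 (hs2 i hi)).resolve_left (hgp _).ne'⟩
      have hw0 : (fun s => g s * ∑ i ∈ Finset.range M, extc b i * gam (l * (s - ζ i))) = fun _ => 0 := by
        funext s
        rw [Finset.sum_eq_zero, mul_zero]
        intro i hi; rw [hb i (Finset.mem_range.1 hi), zero_mul]
      rw [hw0] at Z
      obtain ⟨t, ht1, ht2⟩ := Z
      have hcc := (PP_coef r ⟨t, fun i hi => ht1 i (by omega), fun i hi => ht2 i (by omega)⟩).1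
      ext i
      · have := hcc i i.2
        simpa [extc] using this
      · have := hb i i.2
        simpa [extc] using this) y hy
  exact ⟨extc v.1, extc v.2, hv⟩

lemma perturb {G f u : ℝ → ℝ} {a M : ℝ} (hG : Continuous G) (hf : Continuous f) (hu : Continuous u)
    (hb : ∀ x ∈ Icc 0 a, |G x| ≤ M * f x) (hfp : ∀ x, 0 < f x) (hM : 0 < M)
    (hs : ∀ x ∈ Icc 0 a, ∀ s : ℝ, (s = 1 ∨ s = -1) → G x = s * (M * f x) → s * u x < 0) :
    ∃ η > 0, ∀ x ∈ Icc 0 a, ∀ δ, 0 < δ → δ < η → ∀ p, |p - u x| ≤ η → |G x + δ * p| < M * f x := by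
  have key : ∀ᶠ η in 𝓝 (0:ℝ), ∀ y ∈ Icc 0 a, |G y| ≤ M * f y → ∀ δ, 0 < δ → δ < |η| → ∀ p, |p - u y| ≤ |η| → |G y + δ * p| < M * f y := by
    apply isCompact_Icc.eventually_forall_of_forall_eventually
    intro y hy
    have cont1 : Continuous (fun z : ℝ × ℝ => G z.2) := hG.comp continuous_snd
    have cont2 : Continuous (fun z : ℝ × ℝ => u z.2) := hu.comp continuous_snd
    have cont3 : Continuous (fun z : ℝ × ℝ => f z.2) := hf.comp continuous_snd
    have hfy := mul_pos hM (hfp y)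
    have pest : ∀ (z : ℝ × ℝ) (δ p : ℝ), 0 < δ → δ < |z.1| → |p - u z.2| ≤ |z.1| → |δ * p| ≤ |z.1| * (|u z.2| + |z.1|) := by
      intro z δ p h1 h2 h3
      rw [abs_mul, abs_of_pos h1]
      have : |p| ≤ |u z.2| + |z.1| := by
        have := abs_add_le (u z.2) (p - u z.2)
        rw [add_sub_cancel] at this
        linarith
      exact mul_le_mul h2.le this (abs_nonneg _) (abs_nonneg _)
    rcases lt_or_eq_of_le (hb y hy) with h | h
    · have e1 : ∀ᶠ z : ℝ × ℝ in 𝓝 (0, y), |G z.2| + |z.1| * (|u z.2| + |z.1|) < M * f z.2 := by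
        apply ContinuousAt.eventually_lt
        · fun_prop
        · fun_prop
        · simpa using h
      filter_upwards [e1] with z hz _ δ h1 h2 p h3
      have := pest z δ p h1 h2 h3
      exact (abs_add_le _ _).trans_lt (by linarith)
    · have hsgn : G y = M * f y ∨ G y = -(M * f y) := by
        rcases abs_eq_abs.1 (h.trans (abs_of_pos hfy).symm) with h | h
        · exact Or.inl h
        · exact Or.inr h
      rcases hsgn with h0 | h0
      · have hu0 := hs y hy 1 (Or.inl rfl) (by linarith)
        have e1 : ∀ᶠ z : ℝ × ℝ in 𝓝 (0, y), u z.2 + |z.1| < 0 := by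
          apply ContinuousAt.eventually_lt
          · fun_prop
          · fun_prop
          · simpa using hu0
        have e2 : ∀ᶠ z : ℝ × ℝ in 𝓝 (0, y), |z.1| * (|u z.2| + |z.1|) - G z.2 < M * f z.2 := by
          apply ContinuousAt.eventually_lt
          · fun_prop
          · fun_prop
          · simp; linarith
        filter_upwards [e1, e2] with z hz1 hz2 hz δ h1 h2 p h3
        have p1 := pest z δ p h1 h2 h3
        have p2 := neg_abs_le (δ * p)
        have p3 : p < 0 := by have := le_abs_self (p - u z.2); linarith
        have p4 := mul_neg_of_pos_of_neg h1 p3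
        have p5 := le_abs_self (G z.2)
        rw [abs_lt]; constructor <;> linarith
      · have hu0 := hs y hy (-1) (Or.inr rfl) (by linarith)
        have e1 : ∀ᶠ z : ℝ × ℝ in 𝓝 (0, y), |z.1| - u z.2 < 0 := by
          apply ContinuousAt.eventually_lt
          · fun_prop
          · fun_prop
          · simp; linarith
        have e2 : ∀ᶠ z : ℝ × ℝ in 𝓝 (0, y), |z.1| * (|u z.2| + |z.1|) + G z.2 < M * f z.2 := by
          apply ContinuousAt.eventually_lt
          · fun_prop
          · fun_prop
          · simp; linarith
        filter_upwards [e1, e2] with z hz1 hz2 hz δ h1 h2 p h3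
        have p1 := pest z δ p h1 h2 h3
        have p2 := le_abs_self (δ * p)
        have p3 : 0 < p := by have := neg_abs_le (p - u z.2); linarith
        have p4 := mul_pos h1 p3
        have p5 := neg_abs_le (G z.2)
        rw [abs_lt]; constructor <;> linarith
  obtain ⟨ε, hε, hk⟩ := Metric.eventually_nhds_iff.1 key
  refine ⟨ε / 2, by linarith, fun x hx δ h1 h2 p hp => ?_⟩
  have h3 : |ε / 2| = ε / 2 := abs_of_pos (by linarith)
  exact hk (y := ε / 2) (by rw [dist_zero_right, Real.norm_eq_abs, h3]; linarith) x hx (hb x hx) δ h1 (by rw [h3]; exact h2) p (by rw [h3]; exact hp)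

lemma valid_move {a : ℝ} {m : ℕ} {ξ β : ℕ → ℝ} (hV : ∀ i, ξ i ∈ Icc 0 a) (hs : ∀ i, i + 1 < m → ξ i < ξ (i + 1))
    (hβ : ∀ i, m ≤ i → β i = 0) (h0 : ∀ i < m, 0 < ξ i ∨ 0 ≤ β i) (h1 : ∀ i < m, ξ i < a) :
    ∀ᶠ δ in 𝓝[>] (0:ℝ), Valid a m (fun i => ξ i + δ * β i) := by
  have lim : ∀ i, Tendsto (fun δ : ℝ => ξ i + δ * β i) (𝓝[>] 0) (𝓝 (ξ i)) := by
    intro i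
    have : Continuous (fun δ : ℝ => ξ i + δ * β i) := by fun_prop
    have := (this.tendsto 0).mono_left (nhdsWithin_le_nhds (s := Ioi 0))
    simpa using this
  have e1 : ∀ᶠ δ in 𝓝[>] (0:ℝ), ∀ i ∈ Finset.range m, 0 ≤ ξ i + δ * β i := by
    rw [Filter.eventually_all_finset]
    intro i hi
    rcases h0 i (Finset.mem_range.1 hi) with h | h
    · exact ((lim i).eventually (lt_mem_nhds h)).mono fun _ h => h.le
    · filter_upwards [self_mem_nhdsWithin] with δ hδ
      exact add_nonneg (hV i).1 (mul_nonneg (le_of_lt hδ) h)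
  have e2 : ∀ᶠ δ in 𝓝[>] (0:ℝ), ∀ i ∈ Finset.range m, ξ i + δ * β i < a := by
    rw [Filter.eventually_all_finset]
    intro i hi
    exact (lim i).eventually (gt_mem_nhds (h1 i (Finset.mem_range.1 hi)))
  have e3 : ∀ᶠ δ in 𝓝[>] (0:ℝ), ∀ i ∈ Finset.range m, i + 1 < m → ξ i + δ * β i < ξ (i + 1) + δ * β (i + 1) := by
    rw [Filter.eventually_all_finset]
    intro i hi
    by_cases h : i + 1 < m
    · exact ((lim i).eventually_lt (lim (i + 1)) (hs i h)).mono fun _ h _ => h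
    · exact Eventually.of_forall fun _ h' => absurd h' h
  filter_upwards [e1, e2, e3] with δ a1 a2 a3
  refine ⟨fun i => ?_, fun i hi => (a3 i (Finset.mem_range.2 (by omega)) hi).le⟩
  by_cases h : i < m
  · exact ⟨a1 i (Finset.mem_range.2 h), (a2 i (Finset.mem_range.2 h)).le⟩
  · simp only [hβ i (not_lt.1 h), mul_zero, add_zero]; exact hV i

lemma descent {f g : ℝ → ℝ} (hf : Continuous f) (hfp : ∀ x, 0 < f x) (hg : Continuous g)
    {l a : ℝ} (ha : 0 < a) {r m : ℕ} (hr : 1 ≤ r) {ε M : ℝ} {ξ c : ℕ → ℝ} (hM : 0 < M)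
    (hb : ∀ x ∈ Icc 0 a, |Sp (thl l) g a r m ε ξ c x| ≤ M * f x)
    {d β : ℕ → ℝ} (hmove : ∀ᶠ δ in 𝓝[>] (0:ℝ), Valid a m (fun i => ξ i + δ * β i))
    (hs : ∀ x ∈ Icc 0 a, ∀ s : ℝ, (s = 1 ∨ s = -1) → Sp (thl l) g a r m ε ξ c x = s * (M * f x) →
      s * PP d (fun s => g s * ∑ i ∈ Finset.range m, (ε * 2 * (-1) ^ (i + 1) * (-(l * β i))) * gam (l * (s - ξ i))) r x < 0) :
    ∃ ξ' c' M', Valid a m ξ' ∧ M' < M ∧ ∀ x ∈ Icc 0 a, |Sp (thl l) g a r m ε ξ' c' x| ≤ M' * f x := by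
  set w0 := fun s => g s * ∑ i ∈ Finset.range m, (ε * 2 * (-1) ^ (i + 1) * (-(l * β i))) * gam (l * (s - ξ i)) with hw0
  have cw0 : Continuous w0 := hg.mul (gsum_cont _ _ _ _)
  set w : ℝ → ℝ → ℝ := fun δ s => g s * ((hh (thl l) a m ε (fun i => ξ i + δ * β i) s - hh (thl l) a m ε ξ s) / δ) with hw
  have cw : ∀ δ, Continuous (w δ) := fun δ => hg.mul (((hh_cont _ _ _ _ _).sub (hh_cont _ _ _ _ _)).div_const δ)
  have cG : Continuous (Sp (thl l) g a r m ε ξ c) := PP_cont' (hg.mul (hh_cont _ _ _ _ _)) r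
  obtain ⟨η, hη, hp⟩ := perturb cG hf (PP_cont' cw0 r) hb hfp hM hs
  -- convergence
  have hdiff : ∀ δ s, hh (thl l) a m ε (fun i => ξ i + δ * β i) s - hh (thl l) a m ε ξ s =
      ε * 2 * ∑ i ∈ Finset.range m, (-1) ^ (i + 1) * (Phi (l * (s - (ξ i + δ * β i))) - Phi (l * (s - ξ i))) := by
    intro δ s
    simp only [mul_sub (_ : ℝ) (Phi _), Finset.sum_sub_distrib, hh, thl]
    ring
  have hlim : ∀ s, Tendsto (fun δ => w δ s) (𝓝[>] 0) (𝓝 (w0 s)) := by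
    intro s
    apply Tendsto.const_mul
    have hd : HasDerivAt (fun δ => hh (thl l) a m ε (fun i => ξ i + δ * β i) s)
        (∑ i ∈ Finset.range m, (ε * 2 * (-1) ^ (i + 1) * (-(l * β i))) * gam (l * (s - ξ i))) 0 := by
      have : (fun δ => hh (thl l) a m ε (fun i => ξ i + δ * β i) s) = fun δ => 
        hh (thl l) a m ε ξ s + ∑ i ∈ Finset.range m, ε * 2 * ((-1) ^ (i + 1) * (Phi (l * (s - (ξ i + δ * β i))) - Phi (l * (s - ξ i)))) := by
        funext δ
        rw [← Finset.mul_sum, ← hdiff]; ring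
      rw [this]
      apply HasDerivAt.const_add
      apply HasDerivAt.fun_sum
      intro i _
      have h1 : HasDerivAt (fun δ : ℝ => l * (s - (ξ i + δ * β i))) (l * (-(1 * β i))) 0 :=
        ((((hasDerivAt_id (0:ℝ)).mul_const (β i)).const_add (ξ i)).const_sub s).const_mul l
      have h2 := Phi_deriv (l * (s - (ξ i + 0 * β i)))
      have h3 := ((h2.comp 0 h1).sub_const (Phi (l * (s - ξ i)))).const_mul ((-1 : ℝ) ^ (i + 1)) |>.const_mul (ε * 2)
      refine h3.congr_deriv ?_
      simp only [zero_mul, add_zero]; ring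
    have h2 := (hasDerivAt_iff_tendsto_slope.1 hd).mono_left (nhdsWithin_mono 0 (fun x (hx : 0 < x) => hx.ne') : 𝓝[>] (0:ℝ) ≤ 𝓝[≠] 0)
    refine h2.congr fun δ => ?_
    rw [slope_def_field]; simp
  have hK : ∃ K, ∀ s ∈ Icc 0 a, |g s| ≤ K ∧ |w0 s| ≤ K := by
    obtain ⟨K1, h1⟩ := isCompact_Icc.exists_bound_of_continuousOn (s := Icc 0 a) hg.continuousOn
    obtain ⟨K2, h2⟩ := isCompact_Icc.exists_bound_of_continuousOn (s := Icc 0 a) cw0.continuousOn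
    exact ⟨max K1 K2, fun s hs => ⟨(h1 s hs).trans (le_max_left _ _), (h2 s hs).trans (le_max_right _ _)⟩⟩
  obtain ⟨K, hK⟩ := hK
  have hK0 : 0 ≤ K := (abs_nonneg _).trans (hK 0 ⟨le_rfl, ha.le⟩).1
  set Q := |ε| * 2 * ∑ i ∈ Finset.range m, |l * β i| with hQ
  have hB : ∀ᶠ δ in 𝓝[>] (0:ℝ), ∀ s ∈ Icc 0 a, |w δ s - w0 s| ≤ K * Q + K := by
    filter_upwards [self_mem_nhdsWithin] with δ hδ s hs
    have hδ : 0 < δ := hδ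
    refine (abs_sub _ _).trans (add_le_add ?_ (hK s hs).2)
    rw [hw]; simp only
    rw [abs_mul]
    refine mul_le_mul (hK s hs).1 ?_ (abs_nonneg _) hK0
    rw [abs_div, abs_of_pos hδ, div_le_iff₀ hδ, hdiff, abs_mul, abs_mul, abs_two, hQ, mul_assoc _ _ δ]
    refine mul_le_mul_of_nonneg_left ?_ (by positivity)
    rw [Finset.sum_mul]
    refine (Finset.abs_sum_le_sum_abs _ _).trans (Finset.sum_le_sum fun i _ => ?_)
    rw [abs_mul, abs_pow, abs_neg, abs_one, one_pow, one_mul]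
    refine (Phi_lip _ _).trans (le_of_eq ?_)
    rw [← abs_of_pos hδ, ← abs_mul, abs_of_pos hδ, ← abs_neg]
    congr 1; ring
  have hconv := PP_tendsto (F := 𝓝[>] (0:ℝ)) hr ha.le (c := fun _ => d) (c0 := d) (w := w) (w0 := w0)
    (Eventually.of_forall fun δ => LI.of_cont (cw δ)) (LI.of_cont cw0) (fun _ _ => tendsto_const_nhds) hB
    (Eventually.of_forall fun s _ => hlim s) hη
  have hsmall : ∀ᶠ δ in 𝓝[>] (0:ℝ), δ < η := nhdsWithin_le_nhds (gt_mem_nhds hη)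
  obtain ⟨δ, hδ1, hδ2, hδ3, hδ0⟩ := (hconv.and (hsmall.and (hmove.and self_mem_nhdsWithin))).exists
  have hδ0 : 0 < δ := hδ0
  set G' := Sp (thl l) g a r m ε (fun i => ξ i + δ * β i) (fun j => c j + δ * d j) with hG'
  have hlt : ∀ x ∈ Icc 0 a, |G' x| < M * f x := by
    intro x hx
    have : G' x = Sp (thl l) g a r m ε ξ c x + δ * PP d (w δ) r x := by
      unfold Sp
      rw [← PP_lin (LI_hh hg _ _ _ _ _) (LI.of_cont (cw δ))]
      rw [hG']; unfold Sp
      congr 1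
      funext s
      rw [hw]; field_simp; ring
    rw [this]
    exact hp x hx δ hδ0 hδ2 _ (hδ1 x hx)
  have cG' : Continuous G' := PP_cont' (hg.mul (hh_cont _ _ _ _ _)) r
  obtain ⟨x0, hx0, hmax⟩ := isCompact_Icc.exists_isMaxOn (nonempty_Icc.2 ha.le)
    ((cG'.abs.div hf (fun x => (hfp x).ne')).continuousOn (s := Icc 0 a))
  refine ⟨(fun i => ξ i + δ * β i), (fun j => c j + δ * d j), |G' x0| / f x0, hδ3, ?_, fun x hx => ?_⟩
  · rw [div_lt_iff₀ (hfp _)]; exact hlt x0 hx0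
  · have := hmax hx
    simp only [mem_ofPred_eq, Pi.div_apply] at this
    rw [div_le_iff₀ (hfp x)] at this
    exact this

lemma haar_spline_signed {g : ℝ → ℝ} (hg : Continuous g) (hgp : ∀ x, 0 < g x) {l : ℝ} (hl : 0 < l) {r M N : ℕ}
    (hN : N + 1 = M + r) {ζ : ℕ → ℝ} (hζ : ∀ i, i + 1 < M → ζ i < ζ (i + 1))
    {y : ℕ → ℝ} (hy : ∀ i, i + 1 < N → y i < y (i + 1)) {σ : ℝ} (hσ : σ = 1 ∨ σ = -1) :
    ∃ d b : ℕ → ℝ, ∀ x, ∀ j ≤ N, InGap y N j x →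
      σ * (-1) ^ j * PP d (fun s => g s * ∑ i ∈ Finset.range M, b i * gam (l * (s - ζ i))) r x < 0 := by
  obtain ⟨d, b, h⟩ := haar_spline hg hgp hl hN hζ hy
  refine ⟨fun j => 0 + (-σ) * d j, fun j => (-σ) * b j, fun x j hj hx => ?_⟩
  have e : (fun s => g s * ∑ i ∈ Finset.range M, (-σ * b i) * gam (l * (s - ζ i))) =
      fun s => (fun _ => 0) s + (-σ) * (g s * ∑ i ∈ Finset.range M, b i * gam (l * (s - ζ i))) := by
    funext s
    rw [zero_add, ← mul_assoc, mul_comm (-σ), mul_assoc, Finset.mul_sum (a := -σ)]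
    congr 1
    apply Finset.sum_congr rfl
    intro i _; ring
  rw [e, PP_lin (w := fun _ => 0) (LI.of_cont continuous_const) (LI_gsum hg _ _ _ _), PP_zero_zero]
  have := h x j hj hx
  rcases hσ with rfl | rfl <;> linarith

lemma Sp_split {θ g : ℝ → ℝ} {a : ℝ} {r m : ℕ} {ε : ℝ} {ξ c : ℕ → ℝ} (hLI : LI (fun s => g s * hh θ a m ε ξ s)) (t : ℝ) :
    Sp θ g a r m ε ξ c t = PP c (fun _ => 0) r t + PP (fun _ => 0) (fun s => g s * hh θ a m ε ξ s) r t := by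
  have := PP_lin (c := c) (d := fun _ => 0) (w := fun _ => 0) (LI.of_cont continuous_const) hLI 1 r t
  have h1 : PP (fun _ => 0) (fun s => g s * hh θ a m ε ξ s) r t = 1 * PP (fun _ => 0) (fun s => g s * hh θ a m ε ξ s) r t :=
    (one_mul _).symm
  rw [h1, ← this]
  unfold Sp
  congr 1
  · funext j; ring
  · funext s; ring

lemma w_bound {g : ℝ → ℝ} (hg : Continuous g) {a : ℝ} (ha : 0 < a) (r n : ℕ) (hr : 1 ≤ r) :
    ∃ K, 0 ≤ K ∧ ∀ (θ : ℝ → ℝ) (m : ℕ) (ε : ℝ) (ξ : ℕ → ℝ), (∀ x, |θ x| ≤ 1) → m ≤ n → (ε = 1 ∨ ε = -1) →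
      LI (fun s => g s * hh θ a m ε ξ s) →
      ∀ t ∈ Icc 0 a, |PP (fun _ => 0) (fun s => g s * hh θ a m ε ξ s) r t| ≤ K := by
  obtain ⟨q, rfl⟩ : ∃ q, r = q + 1 := ⟨r - 1, by omega⟩
  obtain ⟨K1, h1⟩ := isCompact_Icc.exists_bound_of_continuousOn (s := Icc 0 a) hg.continuousOn
  have hK1 : 0 ≤ K1 := (norm_nonneg _).trans (h1 0 ⟨le_rfl, ha.le⟩)
  refine ⟨(0 + a * (K1 * (2 * n + 2))) * (1 + a) ^ q, by positivity, fun θ m ε ξ hθ hm hε hLI => ?_⟩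
  apply PP_bound hLI ha.le (fun j => by simp)
  calc ∫ s in (0:ℝ)..a, |g s * hh θ a m ε ξ s| ≤ ∫ s in (0:ℝ)..a, K1 * (2 * n + 2) := by
        apply intervalIntegral.integral_mono_on ha.le (hLI 0 a).abs intervalIntegrable_const
        intro s hs
        rw [abs_mul]
        refine mul_le_mul (h1 s hs) ((hh_bound hθ hε s).trans ?_) (abs_nonneg _) hK1
        have : (m:ℝ) ≤ n := by exact_mod_cast hm
        linarith
    _ = a * (K1 * (2 * n + 2)) := by simp; ring

lemma c_bound {f g : ℝ → ℝ} (hf : Continuous f) (hfp : ∀ x, 0 < f x) (hg : Continuous g) {a : ℝ} (ha : 0 < a)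
    (r n : ℕ) (hr : 1 ≤ r) (K : ℝ) :
    ∃ C, 0 ≤ C ∧ ∀ (θ : ℝ → ℝ) (m : ℕ) (ε : ℝ) (ξ c : ℕ → ℝ), (∀ x, |θ x| ≤ 1) → m ≤ n → (ε = 1 ∨ ε = -1) →
      LI (fun s => g s * hh θ a m ε ξ s) →
      (∀ t ∈ Icc 0 a, |Sp θ g a r m ε ξ c t| ≤ K * f t) → ∀ j < r, |c j| ≤ C := by
  obtain ⟨W, hW0, hW⟩ := w_bound hg ha r n hr
  obtain ⟨C, hC0, hC⟩ := PP_coef_bound r ha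
  obtain ⟨K1, h1⟩ := isCompact_Icc.exists_bound_of_continuousOn (s := Icc 0 a) hf.continuousOn
  have hK1 : 0 ≤ K1 := (norm_nonneg _).trans (h1 0 ⟨le_rfl, ha.le⟩)
  refine ⟨C * (|K| * K1 + W), by positivity, fun θ m ε ξ c hθ hm hε hLI hb => ?_⟩
  apply hC
  intro t ht
  have e := Sp_split (r := r) (c := c) hLI t
  have e2 : PP c (fun _ => 0) r t = Sp θ g a r m ε ξ c t - PP (fun _ => 0) (fun s => g s * hh θ a m ε ξ s) r t := by linarith
  rw [e2]
  refine (abs_sub _ _).trans (add_le_add ?_ (hW θ m ε ξ hθ hm hε hLI t ht))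
  refine (hb t ht).trans ?_
  calc K * f t ≤ |K * f t| := le_abs_self _
    _ = |K| * |f t| := abs_mul _ _
    _ ≤ |K| * K1 := mul_le_mul_of_nonneg_left (h1 t ht) (abs_nonneg _)

lemma start_bound {f g : ℝ → ℝ} (hf : Continuous f) (hfp : ∀ x, 0 < f x) (hg : Continuous g) {a : ℝ} (ha : 0 < a)
    (r : ℕ) (hr : 1 ≤ r) : ∃ K, ∀ (θ : ℝ → ℝ), (∀ x, |θ x| ≤ 1) →
      LI (fun s => g s * hh θ a 0 1 (fun _ => 0) s) →
      ∀ t ∈ Icc 0 a, |Sp θ g a r 0 1 (fun _ => 0) (fun _ => 0) t| ≤ K * f t := by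
  obtain ⟨W, hW0, hW⟩ := w_bound hg ha r 0 hr
  obtain ⟨x0, hx0, hmin⟩ := isCompact_Icc.exists_isMinOn (nonempty_Icc.2 ha.le) (hf.continuousOn (s := Icc 0 a))
  refine ⟨W / f x0, fun θ hθ hLI t ht => (hW θ 0 1 _ hθ le_rfl (Or.inl rfl) hLI t ht).trans ?_⟩
  have h1 : f x0 ≤ f t := hmin ht
  rw [div_mul_eq_mul_div, le_div_iff₀ (hfp x0)]
  exact mul_le_mul_of_nonneg_left h1 hW0

lemma compact_params {f g : ℝ → ℝ} (hf : Continuous f) (hfp : ∀ x, 0 < f x) (hg : Continuous g) {a : ℝ} (ha : 0 < a)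
    (r n : ℕ) (hr : 1 ≤ r) (K : ℝ) (θ : ℕ → ℝ → ℝ) (m : ℕ → ℕ) (ε M : ℕ → ℝ) (ξ c t : ℕ → ℕ → ℝ)
    (hθ : ∀ k x, |θ k x| ≤ 1) (hm : ∀ k, m k ≤ n) (hε : ∀ k, ε k = 1 ∨ ε k = -1)
    (hV : ∀ k, Valid a (m k) (ξ k)) (ht : ∀ k i, t k i ∈ Icc 0 a) (hM : ∀ k, M k ∈ Icc 0 K)
    (hLI : ∀ k, LI (fun s => g s * hh (θ k) a (m k) (ε k) (ξ k) s))
    (hb : ∀ k, ∀ x ∈ Icc 0 a, |Sp (θ k) g a r (m k) (ε k) (ξ k) (c k) x| ≤ M k * f x) :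
    ∃ (φ : ℕ → ℕ) (m0 : ℕ) (ε0 M0 : ℝ) (ξ0 c0 t0 : ℕ → ℝ), StrictMono φ ∧ m0 ≤ n ∧ (ε0 = 1 ∨ ε0 = -1) ∧
      Valid a m0 ξ0 ∧ (∀ i, t0 i ∈ Icc 0 a) ∧ M0 ∈ Icc 0 K ∧ (∀ k, m (φ k) = m0) ∧ (∀ k, ε (φ k) = ε0) ∧
      Tendsto (fun k => M (φ k)) atTop (𝓝 M0) ∧ (∀ i, Tendsto (fun k => ξ (φ k) i) atTop (𝓝 (ξ0 i))) ∧
      (∀ i, Tendsto (fun k => t (φ k) i) atTop (𝓝 (t0 i))) ∧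
      (∀ j < r, Tendsto (fun k => c (φ k) j) atTop (𝓝 (c0 j))) := by
  obtain ⟨C, hC0, hC⟩ := c_bound hf hfp hg ha r n hr K
  have hcb : ∀ k, ∀ j < r, |c k j| ≤ C := fun k => hC (θ k) (m k) (ε k) (ξ k) (c k) (hθ k) (hm k) (hε k) (hLI k)
    (fun x hx => (hb k x hx).trans (mul_le_mul_of_nonneg_right (hM k).2 (hfp x).le))
  have cpt : IsCompact ((Iic n : Set ℕ) ×ˢ (({1, -1} : Set ℝ) ×ˢ (Icc 0 K ×ˢ ((univ.pi fun _ : ℕ => Icc (0:ℝ) a) ×ˢ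
      ((univ.pi fun _ : ℕ => Icc (0:ℝ) a) ×ˢ (univ.pi fun _ : ℕ => Icc (-C) C)))))) := by
    refine (Set.finite_Iic n).isCompact.prod ((Set.toFinite _).isCompact.prod (isCompact_Icc.prod ?_))
    exact (isCompact_univ_pi fun _ => isCompact_Icc).prod ((isCompact_univ_pi fun _ => isCompact_Icc).prod
      (isCompact_univ_pi fun _ => isCompact_Icc))
  obtain ⟨⟨m0, ε0, M0, ξ0, t0, c0⟩, hmem, φ, hφ, hlim⟩ := cpt.isSeqCompact
    (x := fun k => (m k, ε k, M k, ξ k, t k, fun j => if j < r then c k j else 0)) (by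
      intro k
      refine ⟨hm k, ?_, hM k, fun i _ => (hV k).1 i, fun i _ => ht k i, fun j _ => ?_⟩
      · simpa using hε k
      · simp only
        split_ifs with h
        · exact abs_le.1 (hcb k j h)
        · exact ⟨by simpa using hC0, hC0⟩)
  obtain ⟨h1, h2, h3, h4, h5, h6⟩ := hmem
  simp only [nhds_prod_eq] at hlim
  rw [tendsto_prod_iff'] at hlim
  obtain ⟨l1, hlim⟩ := hlim
  rw [tendsto_prod_iff'] at hlim
  obtain ⟨l2, hlim⟩ := hlim
  rw [tendsto_prod_iff'] at hlim
  obtain ⟨l3, hlim⟩ := hlim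
  rw [tendsto_prod_iff'] at hlim
  obtain ⟨l4, hlim⟩ := hlim
  rw [tendsto_prod_iff'] at hlim
  obtain ⟨l5, l6⟩ := hlim
  simp only [Function.comp_def] at l1 l2 l3 l4 l5 l6
  rw [tendsto_pi_nhds] at l4 l5 l6
  have h2 : ε0 = 1 ∨ ε0 = -1 := by simpa using h2
  have e1 : ∀ᶠ k in atTop, m (φ k) = m0 := by
    rw [nhds_discrete, tendsto_pure] at l1; exact l1
  have e2 : ∀ᶠ k in atTop, ε (φ k) = ε0 := by
    filter_upwards [Metric.tendsto_nhds.1 l2 1 one_pos] with k hk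
    rw [Real.dist_eq, abs_lt] at hk
    rcases hε (φ k) with h | h <;> rcases h2 with h' | h' <;> rw [h, h'] at hk ⊢ <;> exfalso <;> linarith [hk.1, hk.2]
  obtain ⟨N, hN⟩ := eventually_atTop.1 (e1.and e2)
  have sh : Tendsto (fun k : ℕ => k + N) atTop atTop := tendsto_add_atTop_nat N
  have m1 : ∀ k, m (φ (k + N)) = m0 := fun k => (hN _ (by omega)).1
  refine ⟨fun k => φ (k + N), m0, ε0, M0, ξ0, c0, t0, fun x y hxy => hφ (by omega), h1, h2, ⟨fun i => h4 i trivial, ?_⟩,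
    fun i => h5 i trivial, h3, m1, fun k => (hN _ (by omega)).2, l3.comp sh,
    fun i => (l4 i).comp sh, fun i => (l5 i).comp sh, fun j hj => ?_⟩
  · intro i hi
    refine le_of_tendsto_of_tendsto' ((l4 i).comp sh) ((l4 (i + 1)).comp sh) fun k => ?_
    have := (hV (φ (k + N))).2 i
    rw [m1] at this
    exact this hi
  · have := (l6 j).comp sh
    simp only [hj, if_true] at this
    exact this

lemma Sp_lim {g : ℝ → ℝ} (hg : Continuous g) {a : ℝ} (ha : 0 < a)
    {r m : ℕ} (hr : 1 ≤ r) {ε : ℝ} (hε : ε = 1 ∨ ε = -1) {θ : ℕ → ℝ → ℝ} {θ0 : ℝ → ℝ} {ξ c : ℕ → ℕ → ℝ} {ξ0 c0 : ℕ → ℝ}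
    (hθ : ∀ k x, |θ k x| ≤ 1) (hθ0 : ∀ x, |θ0 x| ≤ 1)
    (hLI : ∀ k, LI (fun s => g s * hh (θ k) a m ε (ξ k) s)) (hLI0 : LI (fun s => g s * hh θ0 a m ε ξ0 s))
    (hc : ∀ j < r, Tendsto (fun k => c k j) atTop (𝓝 (c0 j)))
    (hlim : ∀ᵐ s, s ∈ Icc 0 a → Tendsto (fun k => θ k s) atTop (𝓝 (θ0 s)) ∧
      (∀ i < m, Tendsto (fun k => θ k (s - ξ k i)) atTop (𝓝 (θ0 (s - ξ0 i)))) ∧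
      Tendsto (fun k => θ k (s - a)) atTop (𝓝 (θ0 (s - a))))
    {t : ℕ → ℝ} {t0 : ℝ} (ht : ∀ k, t k ∈ Icc 0 a) (ht0 : Tendsto t atTop (𝓝 t0)) :
    Tendsto (fun k => Sp (θ k) g a r m ε (ξ k) (c k) (t k)) atTop (𝓝 (Sp θ0 g a r m ε ξ0 c0 t0)) := by
  obtain ⟨K1, h1⟩ := isCompact_Icc.exists_bound_of_continuousOn (s := Icc 0 a) hg.continuousOn
  have hK1 : 0 ≤ K1 := (norm_nonneg _).trans (h1 0 ⟨le_rfl, ha.le⟩)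
  have hcont : Continuous (Sp θ0 g a r m ε ξ0 c0) := by
    obtain ⟨q, rfl⟩ : ∃ q, r = q + 1 := ⟨r - 1, by omega⟩
    exact PP_cont hLI0 q
  have hwl : ∀ᵐ s, s ∈ Icc 0 a → Tendsto (fun k => g s * hh (θ k) a m ε (ξ k) s) atTop (𝓝 (g s * hh θ0 a m ε ξ0 s)) := by
    filter_upwards [hlim] with s hs hs2
    obtain ⟨a1, a2, a3⟩ := hs hs2
    apply Tendsto.const_mul
    unfold hh
    apply Tendsto.const_mul
    refine (a1.add ?_).add (a3.const_mul _)
    apply Tendsto.const_mul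
    apply tendsto_finsetSum
    intro i hi
    exact (a2 i (Finset.mem_range.1 hi)).const_mul _
  have hB : ∀ᶠ k in (atTop : Filter ℕ), ∀ s ∈ Icc 0 a, |g s * hh (θ k) a m ε (ξ k) s - g s * hh θ0 a m ε ξ0 s| ≤ K1 * ((2 * m + 2) + (2 * m + 2)) := by
    refine Eventually.of_forall fun k s hs => ?_
    rw [← mul_sub, abs_mul]
    exact mul_le_mul (h1 s hs) ((abs_sub _ _).trans (add_le_add (hh_bound (hθ k) hε s) (hh_bound hθ0 hε s))) (abs_nonneg _) hK1
  have hcomp : Tendsto (fun k => Sp θ0 g a r m ε ξ0 c0 (t k)) atTop (𝓝 (Sp θ0 g a r m ε ξ0 c0 t0)) :=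
    (hcont.tendsto t0).comp ht0
  have hdiff : Tendsto (fun k => Sp (θ k) g a r m ε (ξ k) (c k) (t k) - Sp θ0 g a r m ε ξ0 c0 (t k)) atTop (𝓝 0) := by
    rw [Metric.tendsto_nhds]
    intro η hη
    have := PP_tendsto (F := (atTop : Filter ℕ)) hr ha.le (c := c) (c0 := c0) (Eventually.of_forall hLI) hLI0 hc hB hwl (half_pos hη)
    filter_upwards [this] with k hk
    rw [dist_zero_right, Real.norm_eq_abs]
    exact (hk (t k) (ht k)).trans_lt (half_lt_self hη)
  simpa using hdiff.add hcomp

def Ach (f g : ℝ → ℝ) (a : ℝ) (r n : ℕ) (l M : ℝ) : Prop :=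
  ∃ m ≤ n, ∃ (ε : ℝ) (ξ c : ℕ → ℝ), (ε = 1 ∨ ε = -1) ∧ Valid a m ξ ∧ ∀ x ∈ Icc 0 a, |Sp (thl l) g a r m ε ξ c x| ≤ M * f x

lemma thl_abs (l x : ℝ) : |thl l x| ≤ 1 := by
  unfold thl; rw [abs_of_nonneg (Phi_nonneg _)]; exact Phi_le_one _

lemma Ach_nonneg {f g : ℝ → ℝ} (hfp : ∀ x, 0 < f x) {a : ℝ} (ha : 0 < a) {r n : ℕ} {l M : ℝ} (h : Ach f g a r n l M) : 0 ≤ M := by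
  obtain ⟨m, -, ε, ξ, c, -, -, hb⟩ := h
  have := (abs_nonneg _).trans (hb 0 ⟨le_rfl, ha.le⟩)
  exact nonneg_of_mul_nonneg_left this (hfp 0)

lemma exists_min {f g : ℝ → ℝ} (hf : Continuous f) (hfp : ∀ x, 0 < f x) (hg : Continuous g) {a : ℝ} (ha : 0 < a)
    (r n : ℕ) (hr : 1 ≤ r) : ∃ K, ∀ l : ℝ, ∃ M ∈ Icc 0 K, Ach f g a r n l M ∧ ∀ M' < M, ¬ Ach f g a r n l M' := by
  obtain ⟨K, hK⟩ := start_bound hf hfp hg ha r hr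
  refine ⟨K, fun l => ?_⟩
  have h0 : Ach f g a r n l K := ⟨0, by omega, 1, fun _ => 0, fun _ => 0, Or.inl rfl,
    ⟨fun _ => ⟨le_rfl, ha.le⟩, fun _ h => by omega⟩, hK (thl l) (thl_abs l) (LI_hh hg _ _ _ _ _)⟩
  set S := {M | Ach f g a r n l M} with hS
  have bdd : BddBelow S := ⟨0, fun M hM => Ach_nonneg hfp ha hM⟩
  obtain ⟨Mk, -, hlim, hmem⟩ := exists_seq_tendsto_sInf (S := S) ⟨K, h0⟩ bdd
  have hmk : ∀ k, ∃ M ∈ Icc 0 K, Ach f g a r n l M ∧ M ≤ Mk k := by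
    intro k
    rcases le_total (Mk k) K with h | h
    · exact ⟨Mk k, ⟨Ach_nonneg hfp ha (hmem k), h⟩, hmem k, le_rfl⟩
    · exact ⟨K, ⟨Ach_nonneg hfp ha h0, le_rfl⟩, h0, h⟩
  choose M hM hA hle using hmk
  have hlim' : Tendsto M atTop (𝓝 (sInf S)) :=
    tendsto_of_tendsto_of_tendsto_of_le_of_le tendsto_const_nhds hlim (fun k => csInf_le bdd (hA k)) hle
  choose m hm ε ξ c hε hV hb using hA
  obtain ⟨φ, m0, ε0, M0, ξ0, c0, t0, hφ, hm0, hε0, hV0, -, hM0, em, eε, lM, lξ, -, lc⟩ :=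
    compact_params hf hfp hg ha r n hr K (fun _ => thl l) m ε M ξ c (fun _ _ => 0) (fun _ => thl_abs l) hm hε hV
      (fun _ _ => ⟨le_rfl, ha.le⟩) hM (fun k => LI_hh hg _ _ _ _ _) hb
  have hMeq : M0 = sInf S := tendsto_nhds_unique lM (hlim'.comp hφ.tendsto_atTop)
  have thc : Continuous (thl l) := by
    have := Phi_cont
    unfold thl; fun_prop
  refine ⟨M0, hM0, ⟨m0, hm0, ε0, ξ0, c0, hε0, hV0, fun x hx => ?_⟩, fun M' hM' hA' => ?_⟩
  · have hL := Sp_lim hg ha hr hε0 (θ := fun _ => thl l) (θ0 := thl l) (ξ := fun k => ξ (φ k)) (c := fun k => c (φ k))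
      (ξ0 := ξ0) (c0 := c0) (m := m0) (fun _ => thl_abs l) (thl_abs l) (fun k => LI_hh hg _ _ _ _ _) (LI_hh hg _ _ _ _ _) lc
      (Eventually.of_forall fun s _ => ⟨tendsto_const_nhds, fun i _ => (thc.tendsto _).comp ((lξ i).const_sub s), tendsto_const_nhds⟩)
      (t := fun _ => x) (fun _ => hx) tendsto_const_nhds
    refine le_of_tendsto_of_tendsto' hL.abs (lM.mul_const (f x)) fun k => ?_
    have := hb (φ k) x hx
    rw [em, eε] at this
    exact this
  · rw [hMeq] at hM'
    exact absurd (csInf_le bdd hA') (not_le.2 hM')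

/-- Nontriviality: a spline is never identically zero on `[0,a]`. -/
lemma Sp_ne {g : ℝ → ℝ} (hg : Continuous g) (hgp : ∀ x, 0 < g x) {l a : ℝ} (hl : 0 < l) (ha : 0 < a) {r m : ℕ} {ε : ℝ}
    (hε : ε = 1 ∨ ε = -1) {ξ c : ℕ → ℝ} (hS : SKn a m ξ) (h : ∀ x ∈ Icc 0 a, Sp (thl l) g a r m ε ξ c x = 0) : False := by
  have Z : ZeroP (PP c (fun s => g s * hh (thl l) a m ε ξ s) r) (m + 3 + r) := by
    refine ⟨fun i => a * (i / (m + 3 + r : ℝ)), fun i _ => ?_, fun i hi => h _ ⟨by positivity, ?_⟩⟩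
    · apply mul_lt_mul_of_pos_left _ ha
      apply div_lt_div_of_pos_right _ (by positivity)
      push_cast; linarith
    · have : (i / (m + 3 + r : ℝ)) ≤ 1 := by
        rw [div_le_one (by positivity)]
        exact_mod_cast hi.le
      calc a * (i / (m + 3 + r : ℝ)) ≤ a * 1 := mul_le_mul_of_nonneg_left this ha.le
        _ = a := mul_one a
  obtain ⟨s, hs1, hs2⟩ := PP_zero (hg.mul (hh_cont _ _ _ _ _)) (m + 3) r Z
  have Z2 : ZeroP (hh (thl l) a m ε ξ) (m + 2 + 1) := ⟨s, hs1, fun i hi => (mul_eq_zero.1 (hs2 i hi)).resolve_left (hgp _).ne'⟩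
  have Z3 := Z2.deriv (hh_deriv l a m ε ξ)
  have := gsum_zero hl (m + 2) (fun i => ε * qk m i * l) (zk a m ξ) (fun i hi => zk_strict ha hS i (by omega)) Z3 0 (by omega)
  simp only [qk, mul_one] at this
  rcases hε with rfl | rfl
  · linarith
  · linarith

lemma hh_cons (θ : ℝ → ℝ) (a : ℝ) (k : ℕ) (ε : ℝ) (ζ : ℕ → ℝ) (h0 : ζ 0 = 0) (s : ℝ) :
    hh θ a (k + 1) (-ε) ζ s = hh θ a k ε (fun j => ζ (j + 1)) s := by
  unfold hh
  rw [Finset.sum_range_succ']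
  have e2 : ∑ x ∈ Finset.range k, (-1 : ℝ) ^ (x + 1 + 1) * θ (s - ζ (x + 1)) =
    - ∑ x ∈ Finset.range k, (-1 : ℝ) ^ (x + 1) * θ (s - ζ (x + 1)) := by
    rw [← Finset.sum_neg_distrib]
    exact Finset.sum_congr rfl fun x _ => by rw [pow_succ _ (x + 1)]; ring
  rw [e2, h0, sub_zero, pow_succ _ (k + 1)]
  ring

lemma Sp_congr {θ g : ℝ → ℝ} {a : ℝ} {r m m' : ℕ} {ε ε' : ℝ} {ξ ξ' c : ℕ → ℝ}
    (h : ∀ s, hh θ a m ε ξ s = hh θ a m' ε' ξ' s) : Sp θ g a r m ε ξ c = Sp θ g a r m' ε' ξ' c := by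
  unfold Sp; simp only [h]

/-- One descent step from a separating configuration. -/
lemma descent2 {f g : ℝ → ℝ} (hf : Continuous f) (hfp : ∀ x, 0 < f x) (hg : Continuous g)
    {l a : ℝ} (hl : 0 < l) (ha : 0 < a) {r n m : ℕ} (hr : 1 ≤ r) (hmn : m ≤ n) {ε M : ℝ} {ξ c : ℕ → ℝ} (hM : 0 < M)
    (hε : ε = 1 ∨ ε = -1)
    (hb : ∀ x ∈ Icc 0 a, |Sp (thl l) g a r m ε ξ c x| ≤ M * f x) {d b : ℕ → ℝ}
    (hV : ∀ i, ξ i ∈ Icc 0 a) (hst : ∀ i, i + 1 < m → ξ i < ξ (i + 1))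
    (h0 : ∀ i < m, 0 < ξ i ∨ 0 ≤ -(ε * (-1) ^ (i + 1) * b i)) (h1 : ∀ i < m, ξ i < a)
    (hs : ∀ x ∈ Icc 0 a, ∀ s : ℝ, (s = 1 ∨ s = -1) → Sp (thl l) g a r m ε ξ c x = s * (M * f x) →
      s * PP d (fun s => g s * ∑ i ∈ Finset.range m, b i * gam (l * (s - ξ i))) r x < 0) :
    ∃ M' < M, Ach f g a r n l M' := by
  have hε2 : ε * ε = 1 := by rcases hε with rfl | rfl <;> norm_num
  set β : ℕ → ℝ := fun i => if i < m then -(ε * (-1) ^ (i + 1) * b i) / (2 * l) else 0 with hβ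
  have e : ∀ s, ∑ i ∈ Finset.range m, (ε * 2 * (-1) ^ (i + 1) * (-(l * β i))) * gam (l * (s - ξ i)) =
      ∑ i ∈ Finset.range m, b i * gam (l * (s - ξ i)) := by
    intro s
    refine Finset.sum_congr rfl fun i hi => ?_
    congr 1
    rw [hβ]; simp only [Finset.mem_range.1 hi, if_true]
    have h3 : ((-1:ℝ) ^ (i + 1)) * (-1) ^ (i + 1) = 1 := by rw [← mul_pow]; norm_num
    have : ε * 2 * (-1) ^ (i + 1) * (-(l * (-(ε * (-1) ^ (i + 1) * b i) / (2 * l)))) =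
      (ε * ε) * (((-1:ℝ) ^ (i + 1)) * (-1) ^ (i + 1)) * b i := by field_simp
    rw [this, h3, hε2]; ring
  obtain ⟨ξ', c', M', q1, q2, q3⟩ := descent hf hfp hg (l := l) ha hr hM hb (d := d) (β := β)
    (valid_move hV hst (fun i hi => by rw [hβ]; simp [not_lt.2 hi]) (fun i hi => (h0 i hi).imp id fun h => by
      rw [hβ]; simp only [hi, if_true]; positivity) h1) (by
      simp only [e]; exact hs)
  exact ⟨M', q2, m, hmn, ε, ξ', c', hε, q1, q3⟩

lemma GAlt.alt {G f : ℝ → ℝ} {a M : ℝ} {k : ℕ} {σ : ℝ} {t : ℕ → ℝ} (hσ : σ = 1 ∨ σ = -1) (hM : 0 < M) (hfp : ∀ x, 0 < f x)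
    (h : GAlt G f a M k σ t) : AltP G k σ := by
  refine ⟨t, h.1, fun i hi => ?_⟩
  rw [h.2.2 i hi]
  have h3 : ((-1:ℝ) ^ i) * (-1) ^ i = 1 := by rw [← mul_pow]; norm_num
  have hs : σ * σ = 1 := by rcases hσ with rfl | rfl <;> norm_num
  have : σ * (-1) ^ i * (σ * (-1) ^ i * (M * f (t i))) = (σ * σ) * (((-1:ℝ) ^ i) * (-1) ^ i) * (M * f (t i)) := by ring
  rw [this, h3, hs]
  have := mul_pos hM (hfp (t i))
  linarith

lemma Sp_alt {g : ℝ → ℝ} (hg : Continuous g) (hgp : ∀ x, 0 < g x) {l a : ℝ} {r m N : ℕ} {ε σ : ℝ} {ξ c : ℕ → ℝ}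
    (h : AltP (Sp (thl l) g a r m ε ξ c) (N + r) σ) : AltP (hh (thl l) a m ε ξ) N (σ * (-1) ^ r) :=
  (PP_alt (hg.mul (hh_cont _ _ _ _ _)) N r σ h).congr_pos hgp (fun _ => rfl)

lemma level_alt {f g : ℝ → ℝ} (hf : Continuous f) (hfp : ∀ x, 0 < f x) (hg : Continuous g) (hgp : ∀ x, 0 < g x)
    {l a : ℝ} (hl : 0 < l) (ha : 0 < a) {r n : ℕ} (hr : 1 ≤ r) {M : ℝ} (hA : Ach f g a r n l M)
    (hmin : ∀ M' < M, ¬ Ach f g a r n l M') :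
    ∃ (ε : ℝ) (ξ c : ℕ → ℝ) (σ : ℝ) (t : ℕ → ℝ), 0 < M ∧ (ε = 1 ∨ ε = -1) ∧ Valid a n ξ ∧ SKn a n ξ ∧
      (∀ x ∈ Icc 0 a, |Sp (thl l) g a r n ε ξ c x| ≤ M * f x) ∧ (σ = 1 ∨ σ = -1) ∧
      GAlt (Sp (thl l) g a r n ε ξ c) f a M (n + r + 1) σ t := by
  have hM0 := Ach_nonneg hfp ha hA
  obtain ⟨m1, hm1, ε1, ξ1, c, hε1, hV1, hb1⟩ := hA
  obtain ⟨m, hm, ε, ξ, hε, hV, hS, he⟩ := red m1 ε1 ξ1 hV1 hε1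
  have hb : ∀ x ∈ Icc 0 a, |Sp (thl l) g a r m ε ξ c x| ≤ M * f x := by
    rw [← Sp_congr (fun s => he (thl l) s)]; exact hb1
  have hmn : m ≤ n := hm.trans hm1
  have hM : 0 < M := by
    rcases hM0.eq_or_lt with h | h
    · exfalso
      refine Sp_ne hg hgp hl ha hε hS fun x hx => abs_eq_zero.1 (le_antisymm ((hb x hx).trans ?_) (abs_nonneg _))
      rw [← h, zero_mul]
    · exact h
  set G := Sp (thl l) g a r m ε ξ c with hG
  have cG : Continuous G := PP_cont' (hg.mul (hh_cont _ _ _ _ _)) r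
  obtain ⟨N, hN⟩ : ∃ N, N + 1 = m + r := ⟨m + r - 1, by omega⟩
  rcases sep_G N (a := a) cG hf hfp hM with ⟨σ, t, hσ, ht⟩ | ⟨σ, y, hσ, hy, hsep⟩
  swap
  · exfalso
    obtain ⟨d, b, hdb⟩ := haar_spline_signed hg hgp hl hN hS.2 hy hσ
    obtain ⟨M', h1, h2⟩ := descent2 hf hfp hg hl ha hr hmn hM hε hb (d := d) (b := b) hV.1 hS.2
      (fun i hi => Or.inl (hS.1 i hi).1) (fun i hi => (hS.1 i hi).2) (by
        intro x hx s hs hGx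
        obtain ⟨j, hj, hgap, rfl⟩ := hsep x hx s hs hGx
        exact hdb x j hj hgap)
    exact hmin M' h1 h2
  rw [show N + 2 = m + r + 1 by omega] at ht
  rcases hmn.eq_or_lt with rfl | hlt
  · exact ⟨ε, ξ, c, σ, t, hM, hε, hV, hS, hb, hσ, ht⟩
  exfalso
  have hAG := ht.alt hσ hM hfp
  rcases sep_G (m + r) (a := a) cG hf hfp hM with ⟨σ', t', hσ', ht'⟩ | ⟨σ', y, hσ', hy, hsep⟩
  · have := ht'.alt hσ' hM hfp
    rw [show m + r + 2 = m + 2 + r by omega] at this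
    exact H1 hl ha hS (Sp_alt hg hgp this)
  set ζ : ℕ → ℝ := fun i => if i = 0 then 0 else ξ (i - 1) with hζ
  have ζ0 : ζ 0 = 0 := by simp [hζ]
  have ζs : ∀ i, ζ (i + 1) = ξ i := fun i => by simp [hζ]
  have hζst : ∀ i, i + 1 < m + 1 → ζ i < ζ (i + 1) := by
    intro i hi
    rcases i with _ | i
    · rw [ζ0, ζs]; exact (hS.1 0 (by omega)).1
    · rw [ζs, ζs]; exact hS.2 i (by omega)
  obtain ⟨d, b, hdb⟩ := haar_spline_signed (M := m + 1) (N := m + r) (r := r) hg hgp hl (by omega) hζst hy hσ'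
  set u := PP d (fun s => g s * ∑ i ∈ Finset.range (m + 1), b i * gam (l * (s - ζ i))) r with hu
  have hsu : ∀ x ∈ Icc 0 a, ∀ s : ℝ, (s = 1 ∨ s = -1) → G x = s * (M * f x) → s * u x < 0 := by
    intro x hx s hs hGx
    obtain ⟨j, hj, hgap, rfl⟩ := hsep x hx s hs hGx
    exact hdb x j hj hgap
  have pm : ∀ i : ℕ, σ * (-1) ^ i = 1 ∨ σ * (-1) ^ i = -1 := by
    intro i
    rcases hσ with rfl | rfl <;> rcases neg_one_pow_eq_or ℝ i with h | h <;> rw [h] <;> norm_num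
  have hAu : AltP u (m + 1 + r) (-σ) := by
    refine ⟨t, fun i hi => ht.1 i (by omega), fun i hi => ?_⟩
    have := hsu (t i) (ht.2.1 i (by omega)) (σ * (-1) ^ i) (pm i) (ht.2.2 i (by omega))
    linarith
  have q1 := gsum_sign hl m b ζ _ (fun i hi => hζst i (by omega))
    ((PP_alt (hg.mul (gsum_cont _ _ _ _)) (m + 1) r _ hAu).congr_pos hgp (fun _ => rfl))
  rw [show m + r + 1 = m + 1 + r by omega] at hAG
  have q2 := H2 hl ha hS (Sp_alt hg hgp hAG)
  have q3 : ε * b 0 < 0 := by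
    rcases pm r with h | h
    · have a1 : -σ * (-1) ^ r = -1 := by linarith
      rw [a1] at q1; rw [h] at q2
      have : 0 < ε := by linarith
      have : b 0 < 0 := by linarith
      exact mul_neg_of_pos_of_neg ‹_› ‹_›
    · have a1 : -σ * (-1) ^ r = 1 := by linarith
      rw [a1] at q1; rw [h] at q2
      have : ε < 0 := by linarith
      have : 0 < b 0 := by linarith
      exact mul_neg_of_neg_of_pos ‹_› ‹_›
  have hGe : G = Sp (thl l) g a r (m + 1) (-ε) ζ c := by
    rw [hG]
    refine (Sp_congr fun s => ?_).symm
    rw [hh_cons _ _ _ _ _ ζ0]; simp only [ζs]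
  obtain ⟨M', h1, h2⟩ := descent2 hf hfp hg hl ha hr (show m + 1 ≤ n from hlt) hM (ε := -ε) (ξ := ζ) (c := c)
      (by rcases hε with rfl | rfl <;> norm_num) (by rw [← hGe]; exact hb) (d := d) (b := b)
      (by
        intro i; rcases i with _ | i
        · rw [ζ0]; exact ⟨le_rfl, ha.le⟩
        · rw [ζs]; exact hV.1 i) hζst
      (by
        intro i hi; rcases i with _ | i
        · right; simp; linarith
        · left; rw [ζs]; exact (hS.1 i (by omega)).1)
      (by
        intro i hi; rcases i with _ | i
        · rw [ζ0]; exact ha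
        · rw [ζs]; exact (hS.1 i (by omega)).2) (by rw [← hGe]; exact hsu)
  exact hmin M' h1 h2

lemma Sp_neg {g : ℝ → ℝ} (hg : Continuous g) {l a : ℝ} {r m : ℕ} {ε : ℝ} {ξ c : ℕ → ℝ} (t : ℝ) :
    Sp (thl l) g a r m (-ε) ξ (fun j => 0 + (-1) * c j) t = -Sp (thl l) g a r m ε ξ c t := by
  unfold Sp
  have e : (fun s => g s * hh (thl l) a m (-ε) ξ s) = fun s => (fun _ => 0) s + (-1) * (g s * hh (thl l) a m ε ξ s) := by
    funext s; unfold hh; ring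
  rw [e, PP_lin (w := fun _ => 0) (LI.of_cont continuous_const) (LI_hh hg _ _ _ _ _), PP_zero_zero]
  ring

lemma level_last {f g : ℝ → ℝ} (hf : Continuous f) (hfp : ∀ x, 0 < f x) (hfa : Antitone f) (hg : Continuous g) (hgp : ∀ x, 0 < g x)
    {l a : ℝ} (hl : 0 < l) (ha : 0 < a) {r n : ℕ} (hr : 1 ≤ r) {M : ℝ} (hA : Ach f g a r n l M)
    (hmin : ∀ M' < M, ¬ Ach f g a r n l M') :
    ∃ (ε : ℝ) (ξ c : ℕ → ℝ) (t : ℕ → ℝ), (ε = 1 ∨ ε = -1) ∧ Valid a n ξ ∧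
      (∀ x ∈ Icc 0 a, |Sp (thl l) g a r n ε ξ c x| ≤ M * f x) ∧ (∀ i, t i ∈ Icc 0 a) ∧ t (n + r) = a ∧
      (∀ i < n + r, t i < t (i + 1)) ∧
      ∀ i ≤ n + r, Sp (thl l) g a r n ε ξ c (t i) = (-1) ^ (r + i) * (M * f (t i)) := by
  obtain ⟨ε, ξ, c, σ, t, hM, hε, hV, hS, hb, hσ, h1, h2, h3⟩ := level_alt hf hfp hg hgp hl ha hr hA hmin
  set G := Sp (thl l) g a r n ε ξ c with hG
  have pm : ∀ i : ℕ, σ * (-1) ^ i = 1 ∨ σ * (-1) ^ i = -1 := by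
    intro i
    rcases hσ with rfl | rfl <;> rcases neg_one_pow_eq_or ℝ i with h | h <;> rw [h] <;> norm_num
  have hT := h2 (n + r) (by omega)
  have hTG := h3 (n + r) (by omega)
  have haG := hb a ⟨ha.le, le_rfl⟩
  have hfT := mul_le_mul_of_nonneg_left (hfa hT.2) hM.le
  have hGa : G a = σ * (-1) ^ (n + r) * (M * f a) := by
    rcases hT.2.eq_or_lt with h | hlt
    · rw [← h]; exact hTG
    have hge : M * f (t (n + r)) ≤ σ * (-1) ^ (n + r) * G a := by
      by_contra hcon
      push Not at hcon
      have hI : IncAlt G (n + r + 1) (-σ) := by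
        refine ⟨fun i => if i ≤ n + r then t i else a, fun i hi => ?_, fun i hi => ?_⟩
        · simp only [show i ≤ n + r by omega, if_true]
          split_ifs with hc
          · exact h1 i (by omega)
          · have : i = n + r := by omega
            rw [this]; exact hlt
        · simp only [show i ≤ n + r by omega, if_true]
          split_ifs with hc
          · rw [h3 i (by omega), h3 (i + 1) (by omega)]
            have hp := pm i
            have f1 := mul_pos hM (hfp (t i))
            have f2 := mul_pos hM (hfp (t (i + 1)))
            have e1 : σ * (-1) ^ (i + 1) = -(σ * (-1) ^ i) := by rw [pow_succ]; ring
            have e2 : -σ * (-1) ^ i = -(σ * (-1) ^ i) := by ring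
            rw [e1, e2]
            rcases hp with hp | hp <;> rw [hp] <;> linarith
          · have : i = n + r := by omega
            rw [this, hTG]
            have e2 : -σ * (-1) ^ (n + r) = -(σ * (-1) ^ (n + r)) := by ring
            rw [e2]
            rcases pm (n + r) with hp | hp <;> rw [hp] at hcon ⊢ <;> linarith
      obtain ⟨q, rfl⟩ : ∃ q, r = q + 1 := ⟨r - 1, by omega⟩
      have hw : Continuous (fun s => g s * hh (thl l) a n ε ξ s) := hg.mul (hh_cont _ _ _ _ _)
      have hD := hI.deriv (PP_deriv' hw q)
      rw [show n + (q + 1) + 1 = n + 2 + q by omega] at hD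
      exact H1 hl ha hS (Sp_alt hg hgp hD)
    rw [abs_le] at haG
    rcases pm (n + r) with hp | hp <;> rw [hp] at hge ⊢ <;> linarith [haG.1, haG.2]
  set t' : ℕ → ℝ := fun i => if i < n + r then t i else a with ht'
  have a1 : ∀ i, t' i ∈ Icc 0 a := by
    intro i; simp only [ht']; split_ifs with h
    · exact h2 i (by omega)
    · exact ⟨ha.le, le_rfl⟩
  have a2 : t' (n + r) = a := by simp [ht']
  have a3 : ∀ i < n + r, t' i < t' (i + 1) := by
    intro i hi; simp only [ht', hi, if_true]; split_ifs with h
    · exact h1 i (by omega)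
    · exact (h1 i (by omega)).trans_le (h2 (i + 1) (by omega)).2
  have a4 : ∀ i ≤ n + r, G (t' i) = σ * (-1) ^ i * (M * f (t' i)) := by
    intro i hi; simp only [ht']; split_ifs with h
    · exact h3 i (by omega)
    · have : i = n + r := by omega
      rw [this]; exact hGa
  by_cases hs : σ = (-1) ^ r
  · refine ⟨ε, ξ, c, t', hε, hV, hb, a1, a2, a3, fun i hi => ?_⟩
    rw [pow_add, ← hs]; exact a4 i hi
  · have hs : -σ = (-1) ^ r := by
      rcases hσ with rfl | rfl <;> rcases neg_one_pow_eq_or ℝ r with h | h <;> rw [h] at hs ⊢ <;> first | exact absurd rfl hs | norm_num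
    refine ⟨-ε, ξ, fun j => 0 + (-1) * c j, t', by rcases hε with rfl | rfl <;> norm_num, hV, fun x hx => ?_, a1, a2, a3, fun i hi => ?_⟩
    · rw [Sp_neg hg, abs_neg]; exact hb x hx
    · rw [Sp_neg hg, pow_add, ← hs, ← hG, a4 i hi]; ring

noncomputable def stp (x : ℝ) : ℝ := if 0 < x then 1 else 0

lemma stp_abs (x : ℝ) : |stp x| ≤ 1 := by unfold stp; split_ifs <;> simp

lemma stp_mono : Monotone stp := by
  intro x y h
  unfold stp; split_ifs with h1 h2 h2
  · exact le_rfl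
  · linarith
  · norm_num
  · exact le_rfl

lemma LI_stp {g : ℝ → ℝ} (hg : Continuous g) (a : ℝ) (m : ℕ) (ε : ℝ) (ξ : ℕ → ℝ) :
    LI (fun s => g s * hh stp a m ε ξ s) := by
  intro x y
  have h : ∀ z, IntervalIntegrable (fun s => stp (s - z)) volume x y := fun z =>
    Monotone.intervalIntegrable fun u v huv => stp_mono (by linarith)
  have h2 : IntervalIntegrable (hh stp a m ε ξ) volume x y := by
    have e : hh stp a m ε ξ = fun s => ∑ i ∈ Finset.range (m + 2), ε * qk m i * stp (s - zk a m ξ i) := by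
      funext s; exact hh_eq _ _ _ _ _ _
    rw [e]
    have := IntervalIntegrable.sum (μ := volume) (a := x) (b := y) (Finset.range (m + 2))
      (f := fun i s => ε * qk m i * stp (s - zk a m ξ i)) (fun i _ => (h _).const_mul _)
    have e2 : (fun s => ∑ i ∈ Finset.range (m + 2), ε * qk m i * stp (s - zk a m ξ i)) =
        ∑ i ∈ Finset.range (m + 2), fun s => ε * qk m i * stp (s - zk a m ξ i) := by
      funext s; simp
    rw [e2]; exact this
  exact h2.continuousOn_mul hg.continuousOn

lemma thl_lim {l x : ℕ → ℝ} {x0 : ℝ} (hl : Tendsto l atTop atTop) (hx : Tendsto x atTop (𝓝 x0)) (h0 : x0 ≠ 0) :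
    Tendsto (fun k => thl (l k) (x k)) atTop (𝓝 (stp x0)) := by
  unfold thl stp
  rcases lt_or_gt_of_ne h0 with h | h
  · rw [if_neg (by linarith)]
    exact Phi_bot.comp (hl.atTop_mul_neg h hx)
  · rw [if_pos h]
    exact Phi_top.comp (hl.atTop_mul_pos h hx)

lemma alt_sum (i : ℕ) : 1 + 2 * ∑ j ∈ Finset.range i, (-1 : ℝ) ^ (j + 1) = (-1) ^ i := by
  induction i with
  | zero => simp
  | succ i ih => rw [Finset.sum_range_succ, mul_add, ← add_assoc, ih, pow_succ]; ring

lemma zk_mono {a : ℝ} {m : ℕ} {ξ : ℕ → ℝ} (ha : 0 < a) (h : SKn a m ξ) {i j : ℕ} (hij : i ≤ j) (hj : j ≤ m + 1) :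
    zk a m ξ i ≤ zk a m ξ j := by
  induction j, hij using Nat.le_induction with
  | base => exact le_rfl
  | succ j _ ih => exact (ih (by omega)).trans (zk_strict ha h j (by omega)).le

lemma hh_stp {a : ℝ} (ha : 0 < a) {m : ℕ} {ε : ℝ} {ξ : ℕ → ℝ} (h : SKn a m ξ) {i : ℕ} (hi : i ≤ m) {s : ℝ}
    (hs : s ∈ Ioo (zk a m ξ i) (zk a m ξ (i + 1))) : hh stp a m ε ξ s = ε * (-1) ^ i := by
  have z0 : zk a m ξ 0 = 0 := rfl
  have za : zk a m ξ (m + 1) = a := by simp [zk]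
  have zs : ∀ j < m, zk a m ξ (j + 1) = ξ j := fun j hj => by simp [zk, hj]
  have s0 : 0 < s := by
    have := zk_mono ha h (Nat.zero_le i) (by omega)
    rw [z0] at this; exact this.trans_lt hs.1
  have sa : s < a := by
    have := zk_mono ha h (show i + 1 ≤ m + 1 by omega) le_rfl
    rw [za] at this; exact hs.2.trans_le this
  unfold hh
  have e1 : stp s = 1 := if_pos s0
  have e2 : stp (s - a) = 0 := if_neg (by linarith)
  have e3 : ∑ j ∈ Finset.range m, (-1 : ℝ) ^ (j + 1) * stp (s - ξ j) = ∑ j ∈ Finset.range i, (-1 : ℝ) ^ (j + 1) := by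
    symm
    rw [← Finset.sum_subset (Finset.range_mono hi)]
    · refine Finset.sum_congr rfl fun j hj => ?_
      have hj := Finset.mem_range.1 hj
      have := zk_mono ha h (show j + 1 ≤ i by omega) (by omega)
      rw [zs j (by omega)] at this
      have : stp (s - ξ j) = 1 := if_pos (by linarith [hs.1])
      rw [this, mul_one]
    · intro j hj hj'
      have hj := Finset.mem_range.1 hj
      have hj' : ¬ j < i := fun h => hj' (Finset.mem_range.2 h)
      have := zk_mono ha h (show i + 1 ≤ j + 1 by omega) (by omega)
      rw [zs j hj] at this
      have : stp (s - ξ j) = 0 := if_neg (by linarith [hs.2])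
      rw [this, mul_zero]
  rw [e1, e2, e3, alt_sum]; ring

lemma PP_contDiff {c : ℕ → ℝ} {w : ℝ → ℝ} (hw : LI w) (q : ℕ) : ContDiff ℝ (q : ℕ) (PP c w (q + 1)) := by
  induction q with
  | zero => exact contDiff_zero.2 (PP_cont hw 0)
  | succ q ih =>
    have := PP_deriv (c := c) hw q
    rw [Nat.cast_add, Nat.cast_one, contDiff_succ_iff_deriv]
    refine ⟨fun x => (this x).differentiableAt, fun h => by simp at h, ?_⟩
    rw [show deriv (PP c w (q + 1 + 1)) = PP c w (q + 1) from funext fun x => (this x).deriv]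
    exact ih

lemma PP_iter {c : ℕ → ℝ} {w : ℝ → ℝ} (hw : LI w) {U : Set ℝ} (hU : IsOpen U) (hc : ContinuousOn w U) (k : ℕ) :
    ContDiffOn ℝ (k : ℕ) (PP c w k) U ∧ ∀ s ∈ U, iteratedDerivWithin k (PP c w k) U s = w s := by
  induction k with
  | zero =>
    refine ⟨contDiffOn_zero.2 hc, fun s _ => ?_⟩
    rw [iteratedDerivWithin_zero]; rfl
  | succ k ih =>
    have hd : ∀ s ∈ U, HasDerivAt (PP c w (k + 1)) (PP c w k s) s := fun s hs =>
      PP_deriv_at hw k s (ih.1.continuousOn.stronglyMeasurableAtFilter hU s hs) (ih.1.continuousOn.continuousAt (hU.mem_nhds hs))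
    have hdw : ∀ s ∈ U, derivWithin (PP c w (k + 1)) U s = PP c w k s := fun s hs => by
      rw [derivWithin_of_isOpen hU hs, (hd s hs).deriv]
    constructor
    · rw [Nat.cast_add, Nat.cast_one, contDiffOn_succ_iff_derivWithin hU.uniqueDiffOn]
      exact ⟨fun s hs => (hd s hs).differentiableAt.differentiableWithinAt, fun h => by simp at h, ih.1.congr hdw⟩
    · intro s hs
      rw [iteratedDerivWithin_succ', ← ih.2 s hs]
      exact iteratedDerivWithin_congr hdw hs

lemma Sp_perfect {g : ℝ → ℝ} (hg : Continuous g) {a : ℝ} (ha : 0 < a) {r m : ℕ} (hr : 1 ≤ r) {ε : ℝ} (hε : ε = 1 ∨ ε = -1)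
    {ξ c : ℕ → ℝ} (h : SKn a m ξ) : PerfectSplineWith g r a m (zk a m ξ) ε (Sp stp g a r m ε ξ c) := by
  refine ⟨hε, rfl, by simp [zk], fun i hi => zk_strict ha h i (by omega), ?_, fun i hi => ?_⟩
  · obtain ⟨q, rfl⟩ : ∃ q, r = q + 1 := ⟨r - 1, by omega⟩
    exact (PP_contDiff (LI_stp hg _ _ _ _) q).contDiffOn
  · have e : ∀ s ∈ Ioo (zk a m ξ i) (zk a m ξ (i + 1)), g s * hh stp a m ε ξ s = ε * (-1) ^ i * g s := fun s hs => by
      rw [hh_stp ha h hi hs]; ring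
    have := PP_iter (c := c) (LI_stp hg a m ε ξ) (isOpen_Ioo (a := zk a m ξ i) (b := zk a m ξ (i + 1)))
      ((hg.continuousOn.const_mul (ε * (-1) ^ i)).congr e) r
    exact ⟨this.1, fun s hs => by rw [← e s hs]; exact this.2 s hs⟩

lemma core {f g : ℝ → ℝ} (hf : Continuous f) (hfp : ∀ x, 0 < f x) (hfa : Antitone f) (hg : Continuous g) (hgp : ∀ x, 0 < g x)
    {a : ℝ} (ha : 0 < a) {r n : ℕ} (hr : 1 ≤ r) : ∃ G, IsExtremalSpline f g r n a G := by
  obtain ⟨K, hK⟩ := exists_min hf hfp hg ha r n hr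
  have hl : ∀ k : ℕ, (0:ℝ) < k + 1 := fun k => by positivity
  choose M hM hA hmin using fun k : ℕ => hK (k + 1)
  choose ε ξ c t hε hV hb ht hta hts hGt using fun k : ℕ => level_last hf hfp hfa hg hgp (hl k) ha hr (hA k) (hmin k)
  obtain ⟨φ, m0, ε0, M0, ξ0, c0, t0, hφ, hm0, hε0, hV0, ht0, hM0, em, eε, lM, lξ, lt, lc⟩ :=
    compact_params hf hfp hg ha r n hr K (fun k : ℕ => thl (k + 1)) (fun _ => n) ε M ξ c t (fun k => thl_abs _) (fun _ => le_rfl) hε hV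
      ht hM (fun k => LI_hh hg _ _ _ _ _) hb
  have em : n = m0 := em 0
  subst em
  have llim : Tendsto (fun k => ((φ k : ℕ) : ℝ) + 1) atTop atTop :=
    tendsto_atTop_add_const_right _ _ (tendsto_natCast_atTop_atTop.comp hφ.tendsto_atTop)
  set G := Sp stp g a r n ε0 ξ0 c0 with hG
  have hlim : ∀ (x : ℕ → ℝ) (x0 : ℝ), (∀ k, x k ∈ Icc 0 a) → Tendsto x atTop (𝓝 x0) →
      Tendsto (fun k => Sp (thl ((φ k : ℕ) + 1)) g a r n ε0 (ξ (φ k)) (c (φ k)) (x k)) atTop (𝓝 (G x0)) := by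
    intro x x0 hx hx0
    refine Sp_lim hg ha hr hε0 (θ := fun k => thl ((φ k : ℕ) + 1)) (ξ := fun k => ξ (φ k)) (c := fun k => c (φ k))
      (fun _ => thl_abs _) stp_abs (fun k => LI_hh hg _ _ _ _ _) (LI_stp hg _ _ _ _) lc ?_ hx hx0
    have hfin : (insert 0 (insert a (ξ0 '' Iio n))).Finite := (((Set.finite_Iio n).image ξ0).insert a).insert 0
    have : ∀ᵐ s : ℝ, s ∉ insert 0 (insert a (ξ0 '' Iio n)) := measure_eq_zero_iff_ae_notMem.1 (hfin.measure_zero volume)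
    filter_upwards [this] with s hs _
    simp only [mem_insert_iff, not_or, mem_image, not_exists, not_and] at hs
    refine ⟨thl_lim llim tendsto_const_nhds hs.1, fun i hi => thl_lim llim ((lξ i).const_sub s) ?_,
      thl_lim llim tendsto_const_nhds (sub_ne_zero.2 hs.2.1)⟩
    exact sub_ne_zero.2 fun h => hs.2.2 i hi h.symm
  have hGb : ∀ x ∈ Icc 0 a, |G x| ≤ M0 * f x := by
    intro x hx
    refine le_of_tendsto_of_tendsto' (hlim (fun _ => x) x (fun _ => hx) tendsto_const_nhds).abs (lM.mul_const (f x)) fun k => ?_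
    have := hb (φ k) x hx
    rw [eε] at this
    exact this
  have hGt0 : ∀ i ≤ n + r, G (t0 i) = (-1) ^ (r + i) * (M0 * f (t0 i)) := by
    intro i hi
    refine tendsto_nhds_unique (hlim (fun k => t (φ k) i) (t0 i) (fun k => ht _ _) (lt i)) ?_
    refine Tendsto.congr (fun k => ?_) ((lM.mul ((hf.tendsto (t0 i)).comp (lt i))).const_mul ((-1) ^ (r + i)))
    have := hGt (φ k) i hi
    rw [eε] at this
    exact this.symm
  have ht0a : t0 (n + r) = a := tendsto_nhds_unique (lt (n + r)) (by simp only [hta]; exact tendsto_const_nhds)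
  have ht0le : ∀ i < n + r, t0 i ≤ t0 (i + 1) := fun i hi =>
    le_of_tendsto_of_tendsto' (lt i) (lt (i + 1)) fun k => (hts (φ k) i hi).le
  obtain ⟨m, hm, ε1, ξ1, hε1, hV1, hS1, he⟩ := red n ε0 ξ0 hV0 hε0
  have hGe : G = Sp stp g a r m ε1 ξ1 c0 := Sp_congr fun s => he stp s
  have hP : PerfectSplineWith g r a m (zk a m ξ1) ε1 G := by
    rw [hGe]; exact Sp_perfect hg ha hr hε1 hS1
  have hMp : 0 < M0 := by
    rcases hM0.1.eq_or_lt with h | h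
    · exfalso
      have hz : ∀ x ∈ Icc 0 a, G x = 0 := fun x hx => by
        have := hGb x hx
        rw [← h, zero_mul] at this
        exact abs_eq_zero.1 (le_antisymm this (abs_nonneg _))
      have hlt := zk_strict ha hS1 0 (by omega)
      obtain ⟨s, hs⟩ := nonempty_Ioo.2 hlt
      have h1 := (hP.2.2.2.2.2 0 (by omega)).2 s hs
      have h2 : iteratedDerivWithin r G (Ioo (zk a m ξ1 0) (zk a m ξ1 (0 + 1))) s = iteratedDerivWithin r (fun _ => (0:ℝ)) (Ioo (zk a m ξ1 0) (zk a m ξ1 (0 + 1))) s := by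
        apply iteratedDerivWithin_congr _ hs
        intro x hx
        apply hz
        have := zk_mono ha hS1 (show 0 + 1 ≤ m + 1 by omega) le_rfl
        rw [show zk a m ξ1 (m + 1) = a by simp [zk]] at this
        exact ⟨(show (0:ℝ) = zk a m ξ1 0 from rfl) ▸ hx.1.le, hx.2.le.trans this⟩
      rw [h2] at h1
      have h3 : iteratedDerivWithin r (fun _ => (0:ℝ)) (Ioo (zk a m ξ1 0) (zk a m ξ1 (0 + 1))) s = 0 := by
        simp
      rw [h3] at h1
      have := hgp s
      rcases hε1 with rfl | rfl <;> simp at h1 <;> linarith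
    · exact h
  have hts0 : ∀ i < n + r, t0 i < t0 (i + 1) := by
    intro i hi
    refine lt_of_le_of_ne (ht0le i hi) fun h => ?_
    have h1 := hGt0 i hi.le
    have h2 := hGt0 (i + 1) hi
    rw [← h, h1, ← add_assoc, pow_succ] at h2
    have := mul_pos hMp (hfp (t0 i))
    rcases neg_one_pow_eq_or ℝ (r + i) with h | h <;> rw [h] at h2 <;> linarith
  have hN : wNorm G f (Icc 0 a) = M0 := by
    apply IsGreatest.csSup_eq
    refine ⟨⟨a, ⟨ha.le, le_rfl⟩, ?_⟩, ?_⟩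
    · have := hGt0 (n + r) le_rfl
      rw [ht0a] at this
      simp only
      rw [this, abs_mul, abs_pow, abs_neg, abs_one, one_pow, one_mul, abs_of_pos (mul_pos hMp (hfp a)), mul_div_cancel_right₀ _ (hfp a).ne']
    · rintro _ ⟨x, hx, rfl⟩
      simp only
      rw [div_le_iff₀ (hfp x)]; exact hGb x hx
  refine ⟨G, ⟨m, hm, zk a m ξ1, ε1, hP⟩, fun i => t0 (i - 1), (ht0 _).1, ht0a, fun i h1 h2 => ?_, fun i h1 h2 => ?_⟩
  · obtain ⟨j, rfl⟩ : ∃ j, i = j + 1 := ⟨i - 1, by omega⟩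
    exact hts0 j (by omega)
  · obtain ⟨j, rfl⟩ : ∃ j, i = j + 1 := ⟨i - 1, by omega⟩
    rw [hN]
    simp only [Nat.add_sub_cancel]
    rw [hGt0 j (by omega), show j + 1 + r + 1 = r + j + 2 by ring, pow_add _ (r + j) 2]
    ring

/-- Theorem 1 (existence): there exists a perfect g-spline in Γ^r_{n,g}[0,a]
with n+r+1 oscillation points. -/
theorem statement0
    (f g : ℝ → ℝ)
    (hf_c : ContinuousOn f (Ici 0)) (hf_pos : ∀ t ∈ Ici (0:ℝ), 0 < f t)
    (hf_anti : AntitoneOn f (Ici 0))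
    (hg_c : ContinuousOn g (Ici 0)) (hg_pos : ∀ t ∈ Ici (0:ℝ), 0 < g t)
    (hg_anti : AntitoneOn g (Ici 0))
    (r : ℕ) (hr : 1 ≤ r) (n : ℕ) (a : ℝ) (ha : 0 < a) :
    ∃ G : ℝ → ℝ, IsExtremalSpline f g r n a G := by
  have hmem : ∀ x : ℝ, max x 0 ∈ Ici (0:ℝ) := fun x => mem_Ici.2 (le_max_right _ _)
  have hmc : Continuous (fun x : ℝ => max x 0) := by fun_prop
  obtain ⟨G, ⟨m, hm, u, ε, hP1, hP2, hP3, hP4, hP5, hP6⟩, b, hb1, hb2, hb3, hb4⟩ :=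
    core (f := fun x => f (max x 0)) (g := fun x => g (max x 0)) (hf_c.comp_continuous hmc hmem) (fun x => hf_pos _ (hmem x))
    (fun x y h => hf_anti (hmem x) (hmem y) (max_le_max_right 0 h)) (hg_c.comp_continuous hmc hmem) (fun x => hg_pos _ (hmem x)) ha hr (n := n)
  have hu : ∀ i ≤ m, 0 ≤ u i := by
    intro i
    induction i with
    | zero => intro _; rw [hP2]
    | succ i ih => intro hi; exact (ih (by omega)).trans (hP4 i (by omega)).le
  have hbp : ∀ i, i + 1 ≤ n + r + 1 → 0 ≤ b (i + 1) := by
    intro i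
    induction i with
    | zero => intro _; exact hb1
    | succ i ih => intro hi; exact (ih (by omega)).trans (hb3 (i + 1) (by omega) (by omega)).le
  have hN : wNorm G (fun x => f (max x 0)) (Icc 0 a) = wNorm G f (Icc 0 a) := by
    unfold wNorm
    congr 1
    apply image_congr
    intro x hx
    simp only [max_eq_left hx.1]
  refine ⟨G, ⟨m, hm, u, ε, hP1, hP2, hP3, hP4, hP5, fun i hi => ⟨(hP6 i hi).1, fun s hs => ?_⟩⟩, b, hb1, hb2, hb3, fun i h1 h2 => ?_⟩
  · have := (hP6 i hi).2 s hs
    simp only [max_eq_left ((hu i hi).trans hs.1.le)] at this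
    exact this
  · have := hb4 i h1 h2
    obtain ⟨j, rfl⟩ : ∃ j, i = j + 1 := ⟨i - 1, by omega⟩
    rw [hN] at this
    simp only [max_eq_left (hbp j h2)] at this
    exact this
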